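/- Let I ⊂ S be a quadratic monomial ideal with linear resolution and let P ⊂ S be a monomial prime ideal (an ideal generated by a subset of the variables) with I ⊆ P. Then P^k I^ℓ has linear quotients for all k, ℓ ≥ 1. -/

import Mathlib

open MvPolynomial

/-- `I` has a `d`-linear (free) resolution: there is a resolution
`... → S^{r 2} → S^{r 1} → S^{r 0} → I → 0` in which the generators of `S^{r 0}` map to
homogeneous generators of `I` of degree `d` and all matrices have entries which are
homogeneous of degree `1`.  (Its existence is equivalent to all graded Betti numbers
`β_{i,j}(I)` vanishing for `j ≠ i + d`.) -/
def HasLinearResolution {K : Type*} [Field K] {σ : Type*}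
    (I : Ideal (MvPolynomial σ K)) (d : ℕ) : Prop :=
  ∃ (r : ℕ → ℕ) (g : Fin (r 0) → MvPolynomial σ K)
    (M : (i : ℕ) → Fin (r i) → Fin (r (i + 1)) → MvPolynomial σ K),
    (∀ j, (g j).IsHomogeneous d) ∧
    I = Ideal.span (Set.range g) ∧
    (∀ i j k, (M i j k).IsHomogeneous 1) ∧
    (∀ v : Fin (r 0) → MvPolynomial σ K,
      (∑ j, v j * g j) = 0 ↔
        ∃ w : Fin (r 1) → MvPolynomial σ K, v = fun j => ∑ k, M 0 j k * w k) ∧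
    (∀ (i : ℕ) (v : Fin (r (i + 1)) → MvPolynomial σ K),
      ((fun j => ∑ k, M i j k * v k) = fun _ => 0) ↔
        ∃ w : Fin (r (i + 2)) → MvPolynomial σ K, v = fun k => ∑ l, M (i + 1) k l * w l)

/-- A monomial ideal `I` has linear quotients: there is an ordering `u 0 > u 1 > ...`
of its minimal monomial generators (given by exponent vectors) such that each colon
ideal `(u 0, ..., u (i-1)) : u i` is generated by variables. -/
def HasLinearQuotients {K : Type*} [Field K] {n : ℕ}
    (I : Ideal (MvPolynomial (Fin n) K)) : Prop :=
  ∃ (m : ℕ) (u : Fin m → (Fin n →₀ ℕ)),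
    (∀ i j : Fin m, u i ≤ u j → i = j) ∧
    I = Ideal.span (Set.range fun i => (MvPolynomial.monomial (u i) (1 : K) :
      MvPolynomial (Fin n) K)) ∧
    ∀ i : Fin m, ∃ s : Set (Fin n),
      Submodule.colon
          (Ideal.span ((fun j => (MvPolynomial.monomial (u j) (1 : K) :
            MvPolynomial (Fin n) K)) '' {j : Fin m | j < i}))
          (Ideal.span {(MvPolynomial.monomial (u i) (1 : K) : MvPolynomial (Fin n) K)})
        = Ideal.span ((fun x => (MvPolynomial.X x : MvPolynomial (Fin n) K)) '' s)

section Koszul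

variable {K : Type*} [Field K] {σ : Type*} [LinearOrder σ]

/-- The sign `(-1) ^ #{t ∈ T | t < i}` of `e_i ∧ e_T`. -/
def koszulSign (K : Type*) [Field K] (i : σ) (T : Finset σ) : K :=
  (-1) ^ (T.filter (· < i)).card

/-- The Koszul differential on the variables; a chain `f` stands for `∑ T, f T • e_T`. -/
noncomputable def koszul (K : Type*) [Field K] (σ : Type*) [Fintype σ] [LinearOrder σ] :
    (Finset σ → MvPolynomial σ K) →ₗ[MvPolynomial σ K] (Finset σ → MvPolynomial σ K) where
  toFun f T := ∑ i ∈ Tᶜ, koszulSign K i T • (X i * f (insert i T))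
  map_add' f g := by
    ext1 T
    simp only [Pi.add_apply, mul_add, smul_add, Finset.sum_add_distrib]
  map_smul' r f := by
    ext1 T
    simp only [Pi.smul_apply, smul_eq_mul, Finset.mul_sum, RingHom.id_apply]
    refine Finset.sum_congr rfl fun i _ => ?_
    rw [mul_smul_comm, mul_left_comm]

lemma koszul_apply [Fintype σ] (f : Finset σ → MvPolynomial σ K) (T : Finset σ) :
    koszul K σ f T = ∑ i ∈ Tᶜ, koszulSign K i T • (X i * f (insert i T)) := rfl

lemma koszulSign_ne_zero (i : σ) (T : Finset σ) : koszulSign K i T ≠ 0 :=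
  pow_ne_zero _ (neg_ne_zero.2 one_ne_zero)

lemma koszulSign_insert_of_lt {i j : σ} {T : Finset σ} (hj : j ∉ T) (h : j < i) :
    koszulSign K i (insert j T) = -koszulSign K i T := by
  unfold koszulSign
  rw [Finset.filter_insert, if_pos h, Finset.card_insert_of_notMem (by simp [hj]), pow_succ]
  ring

lemma koszulSign_insert_of_gt {i j : σ} {T : Finset σ} (h : i < j) :
    koszulSign K i (insert j T) = koszulSign K i T := by
  unfold koszulSign
  rw [Finset.filter_insert, if_neg h.not_gt]

lemma koszulSign_eq_one {i : σ} {T : Finset σ} (h : ∀ t ∈ T, i ≤ t) : koszulSign K i T = 1 := by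
  unfold koszulSign
  rw [Finset.filter_false_of_mem fun t ht => (h t ht).not_gt]
  simp

lemma koszulSign_swap {i j : σ} {T : Finset σ} (hi : i ∉ T) (hj : j ∉ T) (hij : i ≠ j) :
    koszulSign K i T * koszulSign K j (insert i T) +
      koszulSign K j T * koszulSign K i (insert j T) = 0 := by
  rcases lt_or_gt_of_ne hij with h | h
  · rw [koszulSign_insert_of_lt hi h, koszulSign_insert_of_gt h]
    ring
  · rw [koszulSign_insert_of_lt hj h, koszulSign_insert_of_gt h]
    ring

variable [Fintype σ]

lemma koszul_koszul (f : Finset σ → MvPolynomial σ K) : koszul K σ (koszul K σ f) = 0 := by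
  ext1 T
  simp only [koszul_apply, Pi.zero_apply, Finset.mul_sum, Finset.smul_sum, mul_smul_comm, smul_smul]
  rw [Finset.sum_sigma']
  refine Finset.sum_involution (fun p _ => ⟨p.2, p.1⟩) ?_ ?_ ?_ ?_
  · rintro ⟨i, j⟩ h
    simp only [Finset.mem_sigma, Finset.mem_compl, Finset.mem_insert, not_or] at h
    dsimp only
    rw [Finset.insert_comm i j, mul_left_comm (X j), ← add_smul,
      koszulSign_swap h.1 h.2.2 (Ne.symm h.2.1), zero_smul]
  · rintro ⟨i, j⟩ h _ h2
    simp only [Finset.mem_sigma, Finset.mem_compl, Finset.mem_insert, not_or] at h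
    simp only [Sigma.mk.injEq, heq_eq_eq] at h2
    exact h.2.1 h2.1
  · rintro ⟨i, j⟩ h
    simp only [Finset.mem_sigma, Finset.mem_compl, Finset.mem_insert, not_or] at h ⊢
    exact ⟨h.2.2, Ne.symm h.2.1, h.1⟩
  · rintro ⟨i, j⟩ h
    rfl

lemma coeff_koszul (f : Finset σ → MvPolynomial σ K) (T : Finset σ) (a : σ →₀ ℕ) :
    coeff a (koszul K σ f T) = ∑ i ∈ Tᶜ, if i ∈ a.support then
      koszulSign K i T * coeff (a - Finsupp.single i 1) (f (insert i T)) else 0 := by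
  rw [koszul_apply, coeff_sum]
  refine Finset.sum_congr rfl fun i _ => ?_
  rw [coeff_smul, coeff_X_mul', smul_eq_mul]
  split_ifs <;> simp

lemma exists_coeff_eq_ite {σ R : Type*} [CommSemiring R] (p : MvPolynomial σ R)
    (s : Set (σ →₀ ℕ)) [DecidablePred (· ∈ s)] :
    ∃ q : MvPolynomial σ R, ∀ a, coeff a q = if a ∈ s then coeff a p else 0 := by
  classical
  refine ⟨∑ a ∈ p.support with a ∈ s, monomial a (coeff a p), fun a => ?_⟩
  simp only [coeff_sum, coeff_monomial, Finset.sum_ite_eq', Finset.mem_filter, mem_support_iff]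
  by_cases h : coeff a p = 0 <;> simp [h]

/-- The Koszul complex is exact in positive degrees: the contracting homotopy sends `x^a e_T` to
`x^(a - i) e_i ∧ e_T`, where `i` is the least index in `supp a ∪ T`, if `i ∉ T`, and to `0`
otherwise. -/
lemma exists_koszul_eq (f : Finset σ → MvPolynomial σ K) (hf : koszul K σ f = 0)
    (h0 : coeff 0 (f ∅) = 0) : ∃ w, koszul K σ w = f := by
  classical
  have key : ∀ T : Finset σ, ∃ q : MvPolynomial σ K, ∀ h : T.Nonempty, ∀ a : σ →₀ ℕ,
      coeff a q = if ∀ j < T.min' h, a j = 0 then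
        coeff (Finsupp.single (T.min' h) 1 + a) (f (T.erase (T.min' h))) else 0 := by
    intro T
    by_cases h : T.Nonempty
    · obtain ⟨q, hq⟩ := exists_coeff_eq_ite
        (divMonomial (f (T.erase (T.min' h))) (Finsupp.single (T.min' h) 1))
        {a : σ →₀ ℕ | ∀ j < T.min' h, a j = 0}
      exact ⟨q, fun _ a => by rw [hq a, coeff_divMonomial]; rfl⟩
    · exact ⟨0, fun h' => absurd h' h⟩
  choose w hw using key
  have hmin : ∀ (T : Finset σ) (m : σ) (a : σ →₀ ℕ), m ∈ T → (∀ t ∈ T, m ≤ t) →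
      (∀ j < m, a j = 0) → coeff a (w T) = coeff (Finsupp.single m 1 + a) (f (T.erase m)) := by
    intro T m a hm hT ha
    have hne : T.Nonempty := ⟨m, hm⟩
    have : T.min' hne = m := le_antisymm (Finset.min'_le _ _ hm) (Finset.le_min' _ _ _ hT)
    rw [hw T hne, this, if_pos ha]
  have hzero : ∀ (T : Finset σ) (m : σ) (a : σ →₀ ℕ), T.Nonempty → m ∈ a.support →
      (∀ t ∈ T, m < t) → coeff a (w T) = 0 := by
    intro T m a hne hm hT
    rw [hw T hne, if_neg]
    intro h
    exact (Finsupp.mem_support_iff.1 hm) (h m ((Finset.lt_min'_iff _ _).2 hT))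
  refine ⟨w, ?_⟩
  ext T a
  by_cases hne : (a.support ∪ T).Nonempty
  swap
  · rw [Finset.not_nonempty_iff_eq_empty, Finset.union_eq_empty, Finsupp.support_eq_empty] at hne
    obtain ⟨rfl, rfl⟩ := hne
    rw [h0, coeff_koszul]
    simp
  set m := (a.support ∪ T).min' hne with hm
  have hmem : m ∈ a.support ∪ T := Finset.min'_mem _ _
  have hT : ∀ t ∈ T, m ≤ t := fun t ht => Finset.min'_le _ _ (Finset.mem_union_right _ ht)
  have ha : ∀ j < m, a j = 0 := by
    intro j hj
    by_contra h
    exact hj.not_ge (Finset.min'_le _ _ (Finset.mem_union_left _ (Finsupp.mem_support_iff.2 h)))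
  rw [coeff_koszul]
  by_cases hmT : m ∈ T
  · have hT' : insert m (T.erase m) = T := Finset.insert_erase hmT
    have hf' : coeff (a + Finsupp.single m 1) (koszul K σ f (T.erase m)) = 0 := by
      rw [hf]; simp
    rw [coeff_koszul, Finset.compl_erase, Finset.sum_insert (by simpa using hmT), if_pos (by simp),
      koszulSign_eq_one (fun t ht => hT t (Finset.mem_of_mem_erase ht)), hT',
      add_tsub_cancel_right, one_mul] at hf'
    rw [eq_neg_of_add_eq_zero_left hf', ← Finset.sum_neg_distrib]
    refine Finset.sum_congr rfl fun i hi => ?_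
    have hiT : i ∉ T := Finset.mem_compl.1 hi
    have him : i ≠ m := fun h => hiT (h ▸ hmT)
    by_cases his : i ∈ a.support
    · have hmi : m < i := lt_of_le_of_ne (Finset.min'_le _ _ (Finset.mem_union_left _ his)) him.symm
      have hle : Finsupp.single i 1 ≤ a := by
        rw [Finsupp.single_le_iff]
        exact Nat.one_le_iff_ne_zero.2 (Finsupp.mem_support_iff.1 his)
      rw [if_pos his, if_pos (by simp at his ⊢; omega), hmin (insert i T) m _ (by simp [hmT])
        (by simpa using ⟨hmi.le, hT⟩) (fun j hj => by simp [ha j hj])]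
      rw [Finset.erase_insert_of_ne him, add_comm a, add_tsub_assoc_of_le hle]
      conv_lhs => rw [← hT', koszulSign_insert_of_lt (Finset.notMem_erase _ _) hmi]
      rw [hT']
      ring
    · rw [if_neg his, if_neg, neg_zero]
      simp only [Finsupp.mem_support_iff, Finsupp.add_apply, not_not] at his ⊢
      simp [his, him.symm]
  · have hma : m ∈ a.support := (Finset.mem_union.1 hmem).resolve_right hmT
    have hlt : ∀ t ∈ T, m < t := fun t ht => lt_of_le_of_ne (hT t ht) fun h => hmT (h ▸ ht)
    have hle : Finsupp.single m 1 ≤ a := by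
      rw [Finsupp.single_le_iff]
      exact Nat.one_le_iff_ne_zero.2 (Finsupp.mem_support_iff.1 hma)
    rw [Finset.sum_eq_single_of_mem m (by simpa using hmT), if_pos hma, koszulSign_eq_one hT,
      hmin (insert m T) m _ (by simp) (by simpa using hT) (fun j hj => by simp [ha j hj]),
      Finset.erase_insert hmT, add_tsub_cancel_of_le hle, one_mul]
    intro i hi him
    split_ifs with his
    · have hmi : m < i := lt_of_le_of_ne (Finset.min'_le _ _ (Finset.mem_union_left _ his)) him.symm
      rw [hzero (insert i T) m _ (by simp) _ (by simpa using ⟨hmi, hlt⟩), mul_zero]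
      simp only [Finsupp.mem_support_iff] at hma ⊢
      simpa [Finsupp.single_apply, him] using hma
    · rfl

lemma homogeneousComponent_add_mul {σ R : Type*} [CommSemiring R] {g : MvPolynomial σ R} {d : ℕ}
    (hg : g.IsHomogeneous d) (e : ℕ) (w : MvPolynomial σ R) :
    homogeneousComponent (d + e) (g * w) = g * homogeneousComponent e w := by
  classical
  ext a
  rw [coeff_homogeneousComponent, coeff_mul, coeff_mul]
  have key : ∀ x ∈ Finset.HasAntidiagonal.antidiagonal a,
      coeff x.1 g ≠ 0 → (a.degree = d + e ↔ x.2.degree = e) := by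
    intro x hx hc
    have h1 : x.1.degree = d := by
      by_contra h
      exact hc (hg.coeff_eq_zero h)
    rw [← Finset.HasAntidiagonal.mem_antidiagonal.1 hx, map_add, h1]
    omega
  split_ifs with h
  · refine Finset.sum_congr rfl fun x hx => ?_
    by_cases hc : coeff x.1 g = 0
    · simp [hc]
    · rw [coeff_homogeneousComponent, if_pos ((key x hx hc).1 h)]
  · refine (Finset.sum_eq_zero fun x hx => ?_).symm
    by_cases hc : coeff x.1 g = 0
    · simp [hc]
    · rw [coeff_homogeneousComponent, if_neg (mt (key x hx hc).2 h), mul_zero]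

lemma koszul_sum_smul {a : Type*} [Fintype a] (m : a → MvPolynomial σ K)
    (y : a → Finset σ → MvPolynomial σ K) (T : Finset σ) :
    koszul K σ (∑ j, m j • y j) T = ∑ j, m j * koszul K σ (y j) T := by
  simp [map_sum, Finset.sum_apply]

lemma isHomogeneous_koszul {f : Finset σ → MvPolynomial σ K} {d : ℕ}
    (hf : ∀ T, (f T).IsHomogeneous d) (T : Finset σ) :
    (koszul K σ f T).IsHomogeneous (1 + d) := by
  rw [koszul_apply]
  refine IsHomogeneous.sum _ _ _ fun i _ => ?_
  rw [smul_eq_C_mul]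
  exact ((isHomogeneous_X K i).mul (hf _)).C_mul _

/-- A chain with linear entries whose boundary lies in the image of the `i`-th matrix of a linear
resolution is, up to the image of that matrix, itself a boundary. -/
lemma exists_koszul_add_of_linear (r : ℕ → ℕ)
    (M : (i : ℕ) → Fin (r i) → Fin (r (i + 1)) → MvPolynomial σ K)
    (hM : ∀ i j k, (M i j k).IsHomogeneous 1)
    (hex : ∀ (i : ℕ) (v : Fin (r (i + 1)) → MvPolynomial σ K),
      ((fun j => ∑ k, M i j k * v k) = fun _ => 0) ↔
        ∃ w : Fin (r (i + 2)) → MvPolynomial σ K, v = fun k => ∑ l, M (i + 1) k l * w l)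
    (q i : ℕ) (y : Fin (r i) → Finset σ → MvPolynomial σ K)
    (hy : ∀ j T, (y j T).IsHomogeneous 1) (hq : ∀ j T, T.card ≠ q → y j T = 0)
    (hr : ∀ T, ∃ w : Fin (r (i + 1)) → MvPolynomial σ K,
      ∀ j, koszul K σ (y j) T = ∑ k, M i j k * w k) :
    ∃ (w : Fin (r i) → Finset σ → MvPolynomial σ K)
      (w' : Fin (r (i + 1)) → Finset σ → MvPolynomial σ K),
      ∀ j, y j = koszul K σ (w j) + ∑ k, M i j k • w' k := by
  induction q generalizing i with
  | zero =>
    have : ∀ j, ∃ w, koszul K σ w = y j := by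
      intro j
      refine exists_koszul_eq _ ?_ ((hy j ∅).coeff_eq_zero (by simp))
      ext1 T
      rw [koszul_apply]
      refine Finset.sum_eq_zero fun i _ => ?_
      rw [hq, mul_zero, smul_zero]
      simp
    choose w hw using this
    exact ⟨w, 0, fun j => by simp [hw]⟩
  | succ q ih =>
    have : ∀ T : Finset σ, ∃ v : Fin (r (i + 1)) → MvPolynomial σ K,
        (∀ j, koszul K σ (y j) T = ∑ k, M i j k * v k) ∧ (∀ k, (v k).IsHomogeneous 1) ∧
        (T.card ≠ q → ∀ k, v k = 0) := by
      intro T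
      by_cases hT : T.card = q
      · obtain ⟨w, hw⟩ := hr T
        refine ⟨fun k => homogeneousComponent 1 (w k), fun j => ?_,
          fun k => homogeneousComponent_isHomogeneous _ _, fun h => absurd hT h⟩
        rw [← homogeneousComponent_eq_self (isHomogeneous_koszul (hy j) T), hw, map_sum]
        exact Finset.sum_congr rfl fun k _ => homogeneousComponent_add_mul (hM i j k) 1 _
      · refine ⟨0, fun j => ?_, fun k => isHomogeneous_zero _ _ _, fun _ _ => rfl⟩
        rw [koszul_apply]
        simp only [Pi.zero_apply, mul_zero, Finset.sum_const_zero]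
        refine Finset.sum_eq_zero fun x hx => ?_
        rw [hq, mul_zero, smul_zero]
        rw [Finset.card_insert_of_notMem (by simpa using hx)]
        omega
    choose v hv hv1 hv0 using this
    have hky : ∀ j, koszul K σ (y j) = ∑ k, M i j k • fun T => v T k := by
      intro j
      ext1 T
      simp [hv, Finset.sum_apply]
    obtain ⟨w, w', hw⟩ := ih (i + 1) (fun k T => v T k) (fun k T => hv1 T k)
      (fun k T h => hv0 T h k) (by
        intro T
        obtain ⟨w, hw⟩ := (hex i fun k => koszul K σ (fun T => v T k) T).1 (by
          ext1 j
          rw [← koszul_sum_smul, ← hky, koszul_koszul]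
          rfl)
        exact ⟨w, fun j => congrFun hw j⟩)
    have hzero : ∀ j, ∑ k, M i j k • ∑ l, M (i + 1) k l • w' l = 0 := by
      intro j
      ext1 T
      have := congrFun ((hex i fun k => ∑ l, M (i + 1) k l * w' l T).2 ⟨_, rfl⟩) j
      simpa [Finset.sum_apply] using this
    have hcyc : ∀ j, ∃ x, koszul K σ x = y j - ∑ k, M i j k • w k := by
      intro j
      refine exists_koszul_eq _ ?_ ?_
      · rw [map_sub, hky, map_sum]
        have : ∀ k, (fun T => v T k) = koszul K σ (w k) + ∑ l, M (i + 1) k l • w' l := hw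
        simp only [this, smul_add, Finset.sum_add_distrib, hzero, map_smul]
        simp
      · simp only [Pi.sub_apply, Finset.sum_apply, Pi.smul_apply, smul_eq_mul, coeff_sub, coeff_sum]
        rw [(hy j ∅).coeff_eq_zero (by simp), Finset.sum_eq_zero, sub_zero]
        intro k _
        rw [← constantCoeff_eq, map_mul, constantCoeff_eq, (hM i j k).coeff_eq_zero (by simp),
          zero_mul]
    choose x hx using hcyc
    exact ⟨x, w, fun j => by rw [hx]; simp⟩

lemma exists_koszul_eq_of_mem {I : Ideal (MvPolynomial σ K)} {d : ℕ}
    (hI : HasLinearResolution I d)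
    (p : ℕ) (z : Finset σ → MvPolynomial σ K) (hz : ∀ T, z T ∈ I)
    (hh : ∀ T, (z T).IsHomogeneous (d + 1)) (hp : ∀ T, T.card ≠ p → z T = 0)
    (hk : koszul K σ z = 0) :
    ∃ c : Finset σ → MvPolynomial σ K, (∀ T, c T ∈ I) ∧ koszul K σ c = z := by
  obtain ⟨r, g, M, hg, rfl, hM, hex0, hex⟩ := hI
  have : ∀ T, ∃ v : Fin (r 0) → MvPolynomial σ K, (z T = ∑ j, g j * v j) ∧
      (∀ j, (v j).IsHomogeneous 1) ∧ (T.card ≠ p → ∀ j, v j = 0) := by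
    intro T
    by_cases hT : T.card = p
    · obtain ⟨w, hw⟩ := (Ideal.mem_span_range_iff_exists_fun).1 (hz T)
      refine ⟨fun j => homogeneousComponent 1 (w j), ?_,
        fun j => homogeneousComponent_isHomogeneous _ _, fun h => absurd hT h⟩
      rw [← homogeneousComponent_eq_self (hh T), ← hw, map_sum]
      refine Finset.sum_congr rfl fun j _ => ?_
      rw [mul_comm]
      exact homogeneousComponent_add_mul (hg j) 1 _
    · exact ⟨0, by simp [hp T hT], fun j => isHomogeneous_zero _ _ _, fun _ _ => rfl⟩
  choose v hv hv1 hv0 using this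
  have hzv : z = ∑ j, g j • fun T => v T j := by
    ext1 T
    simp [hv, Finset.sum_apply]
  obtain ⟨w, w', hw⟩ := exists_koszul_add_of_linear r M hM hex p 0 (fun j T => v T j)
    (fun j T => hv1 T j) (fun j T h => hv0 T h j) (by
      intro T
      obtain ⟨w, hw⟩ := (hex0 fun j => koszul K σ (fun T => v T j) T).1 (by
        simp only [mul_comm _ (g _)]
        rw [← koszul_sum_smul, ← hzv, hk]
        rfl)
      exact ⟨w, fun j => congrFun hw j⟩)
  refine ⟨∑ j, g j • w j, fun T => ?_, ?_⟩
  · simp only [Finset.sum_apply, Pi.smul_apply, smul_eq_mul]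
    exact Ideal.sum_mem _ fun j _ => Ideal.mul_mem_right _ _ (Ideal.subset_span ⟨j, rfl⟩)
  · have hzero : ∑ j, g j • ∑ k, M 0 j k • w' k = 0 := by
      ext1 T
      have := (hex0 fun j => ∑ k, M 0 j k * w' k T).2 ⟨_, rfl⟩
      simpa [Finset.sum_apply, mul_comm (g _)] using this
    have hw : ∀ j, (fun T => v T j) = koszul K σ (w j) + ∑ k, M 0 j k • w' k := hw
    simp only [hzv, hw, smul_add, Finset.sum_add_distrib, hzero, map_sum, map_smul, add_zero]

/-- If `x^e` lies outside `I` but `x_i x^e ∈ I` for all `i ∈ T₀`, then modulo `I` the chain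
`-x^e e_{T₀}` lifts to a Koszul cycle. -/
lemma exists_koszul_cycle {I : Ideal (MvPolynomial σ K)} {d : ℕ}
    (hI : HasLinearResolution I d)
    (hmon : ∀ p ∈ I, ∀ e, coeff e p ≠ 0 → monomial e (1 : K) ∈ I)
    (T₀ : Finset σ) (e₀ : σ →₀ ℕ) (hd : e₀.degree = d)
    (hT : ∀ i ∈ T₀, monomial (Finsupp.single i 1 + e₀) (1 : K) ∈ I) :
    ∃ δ : Finset σ → MvPolynomial σ K, koszul K σ δ = 0 ∧
      ∀ T e, monomial e (1 : K) ∉ I → (coeff e (δ T) ≠ 0 ↔ T = T₀ ∧ e = e₀) := by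
  classical
  set α : Finset σ → MvPolynomial σ K := fun T => if T = T₀ then monomial e₀ 1 else 0 with hα
  have hαh : ∀ T, (α T).IsHomogeneous d := by
    intro T
    simp only [hα]
    split_ifs
    · exact isHomogeneous_monomial _ hd
    · exact isHomogeneous_zero _ _ _
  obtain ⟨c, hcI, hc⟩ := exists_koszul_eq_of_mem hI (T₀.card - 1) (koszul K σ α)
    (by
      intro T
      rw [koszul_apply]
      refine Ideal.sum_mem _ fun i hi => ?_
      rw [smul_eq_C_mul]
      refine Ideal.mul_mem_left _ _ ?_
      simp only [hα]
      split_ifs with h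
      · have := hT i (h ▸ Finset.mem_insert_self i T)
        rwa [X, monomial_mul, one_mul]
      · simp)
    (fun T => by rw [add_comm]; exact isHomogeneous_koszul hαh T)
    (by
      intro T hcard
      rw [koszul_apply]
      refine Finset.sum_eq_zero fun i hi => ?_
      simp only [hα]
      rw [if_neg, mul_zero, smul_zero]
      rintro rfl
      rw [Finset.card_insert_of_notMem (by simpa using hi)] at hcard
      exact hcard rfl)
    (koszul_koszul α)
  refine ⟨c - α, by rw [map_sub, hc, sub_self], fun T e he => ?_⟩
  have h0 : coeff e (c T) = 0 := by
    by_contra h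
    exact he (hmon _ (hcI T) e h)
  rw [Pi.sub_apply, coeff_sub, h0, zero_sub, neg_ne_zero]
  simp only [hα]
  by_cases hTT : T = T₀
  · simp [hTT, coeff_monomial, eq_comm]
  · simp [hTT]

end Koszul

lemma monomial_mem_of_le {σ R : Type*} [CommSemiring R] {I : Ideal (MvPolynomial σ R)}
    {e e' : σ →₀ ℕ} (h : e ≤ e') (he : monomial e (1 : R) ∈ I) : monomial e' (1 : R) ∈ I := by
  have := Ideal.mul_mem_left I (monomial (e' - e) 1) he
  rwa [monomial_mul, one_mul, tsub_add_cancel_of_le h] at this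

section Graph

variable {K : Type*} [Field K] {σ : Type*} [Fintype σ] [LinearOrder σ]

lemma adj_or_adj_of_loop {I : Ideal (MvPolynomial σ K)} (hI : HasLinearResolution I 2)
    (hmon : ∀ p ∈ I, ∀ e, coeff e p ≠ 0 → monomial e (1 : K) ∈ I) {A : σ → σ → Prop}
    (hA : ∀ i j, A i j ↔ monomial (Finsupp.single i 1 + Finsupp.single j 1) (1 : K) ∈ I)
    {i j k : σ} (hi : A i i) (hjk : A j k) (hij : i ≠ j) (hik : i ≠ k) : A i j ∨ A i k := by
  by_contra! hcon
  obtain ⟨hnj, hnk⟩ := hcon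
  rw [hA] at hi hjk hnj hnk
  obtain ⟨δ, hδ, hc⟩ := exists_koszul_cycle hI hmon {i, k}
    (Finsupp.single i 1 + Finsupp.single j 1) (by simp) (by
      intro m hm
      rcases Finset.mem_insert.1 hm with rfl | hm
      · exact monomial_mem_of_le (by rw [← add_assoc]; exact le_self_add) hi
      · rw [Finset.mem_singleton.1 hm]
        refine monomial_mem_of_le ?_ hjk
        rw [add_left_comm, add_comm (Finsupp.single k 1)]
        exact le_add_self)
  have h := coeff_koszul δ {i} (Finsupp.single i 1 + Finsupp.single j 1 + Finsupp.single k 1)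
  rw [hδ, Finset.sum_eq_single k] at h
  · rw [if_pos (by simp), add_tsub_cancel_right, Pi.zero_apply, coeff_zero, eq_comm, mul_eq_zero,
      or_iff_right (koszulSign_ne_zero _ _)] at h
    exact (hc _ _ hnj).2 ⟨Finset.pair_comm _ _, rfl⟩ h
  · intro m hm hmk
    split_ifs with hms
    · have hmi : m ≠ i := by simpa using hm
      have hmj : m = j := by
        by_contra hmj
        simp [hmk.symm, hmi.symm, Ne.symm hmj] at hms
      subst hmj
      rw [add_right_comm, add_tsub_cancel_right, mul_eq_zero]
      right
      by_contra h
      have := ((hc _ _ hnk).1 h).2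
      exact hmk (Finsupp.single_left_injective one_ne_zero (add_left_cancel this)).symm
    · rfl
  · simp [hik.symm]

/-- A separation property: the vertices of `W` other than `a` can be two-coloured such that
non-adjacent vertices have the same colour, while `x` is separated from the other non-neighbours
of `a`. -/
lemma exists_separation {I : Ideal (MvPolynomial σ K)} (hI : HasLinearResolution I 2)
    (hmon : ∀ p ∈ I, ∀ e, coeff e p ≠ 0 → monomial e (1 : K) ∈ I) {A : σ → σ → Prop}
    (hA : ∀ i j, A i j ↔ monomial (Finsupp.single i 1 + Finsupp.single j 1) (1 : K) ∈ I)
    (W : Finset σ) {a x : σ} (ha : a ∈ W) (hax : a ≠ x) (hnax : ¬ A a x)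
    (hW : ∀ z ∈ W, z ≠ a → z ≠ x → A z a ∨ A z x) :
    ∃ Z : σ → Prop, ¬ Z x ∧ (∀ y ∈ W, y ≠ a → y ≠ x → ¬ A a y → Z y) ∧
      ∀ p ∈ W, ∀ q ∈ W, p ≠ a → q ≠ a → p ≠ q → ¬ A p q → (Z p ↔ Z q) := by
  obtain ⟨δ, hδ, hc⟩ := exists_koszul_cycle hI hmon (W \ {a, x})
    (Finsupp.single a 1 + Finsupp.single x 1) (by simp) (by
      intro z hz
      simp only [Finset.mem_sdiff, Finset.mem_insert, Finset.mem_singleton, not_or] at hz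
      rcases hW z hz.1 hz.2.1 hz.2.2 with h | h <;> rw [hA] at h
      · exact monomial_mem_of_le (by rw [← add_assoc]; exact le_self_add) h
      · exact monomial_mem_of_le (by rw [add_left_comm]; exact le_add_self) h)
  refine ⟨fun p => coeff (Finsupp.single a 1 + Finsupp.single p 1) (δ (W \ {a, p})) = 0,
    (hc _ _ (by rwa [← hA])).2 ⟨rfl, rfl⟩, ?_, ?_⟩
  · intro y hy hya hyx hay
    by_contra h
    have h1 := ((hc _ _ (by rwa [← hA])).1 h).1
    have : y ∈ W \ {a, x} := by simp [hy, hya, hyx]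
    rw [← h1] at this
    simp at this
  · intro p hp q hq hpa hqa hpq hnpq
    have h := coeff_koszul δ (W \ {a, p, q})
      (Finsupp.single a 1 + Finsupp.single p 1 + Finsupp.single q 1)
    have hsub : ({p, q} : Finset σ) ⊆ (W \ {a, p, q})ᶜ := by
      intro m hm
      simp only [Finset.mem_insert, Finset.mem_singleton] at hm
      simp only [Finset.mem_compl, Finset.mem_sdiff, Finset.mem_insert, Finset.mem_singleton]
      tauto
    have hp' : insert p (W \ {a, p, q}) = W \ {a, q} := by
      ext m
      simp only [Finset.mem_insert, Finset.mem_sdiff, Finset.mem_singleton]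
      grind
    have hq' : insert q (W \ {a, p, q}) = W \ {a, p} := by
      ext m
      simp only [Finset.mem_insert, Finset.mem_sdiff, Finset.mem_singleton]
      grind
    rw [hδ, ← Finset.sum_subset hsub, Finset.sum_pair hpq, if_pos (by simp), if_pos (by simp),
      add_tsub_cancel_right, add_right_comm, add_tsub_cancel_right, hp', hq', Pi.zero_apply,
      coeff_zero] at h
    · have h1 := koszulSign_ne_zero (K := K) p (W \ {a, p, q})
      have h2 := koszulSign_ne_zero (K := K) q (W \ {a, p, q})
      constructor <;> intro h0 <;> rw [h0] at h <;> simpa [h1, h2] using h.symm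
    · intro m hm hmpq
      split_ifs with hms
      · simp only [Finset.mem_insert, Finset.mem_singleton, not_or] at hmpq
        have hma : m = a := by
          by_contra hma
          simp [Ne.symm hmpq.1, Ne.symm hmpq.2, Ne.symm hma] at hms
        subst hma
        rw [add_assoc, add_tsub_cancel_left, mul_eq_zero]
        right
        by_contra h
        have h1 := ((hc _ _ (by rwa [← hA])).1 h).2
        have h2 := DFunLike.congr_fun h1 m
        simp [hpa, hqa, hax.symm] at h2
      · rfl

end Graph

section Elimination

variable {σ : Type*} [DecidableEq σ] {A : σ → σ → Prop}

lemma exists_simplicial (hsymm : ∀ i j, A i j → A j i)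
    (hsep : ∀ (W : Finset σ) (a x : σ), a ∈ W → x ∈ W → a ≠ x → ¬ A a x →
      (∀ z ∈ W, z ≠ a → z ≠ x → A z a ∨ A z x) →
      ∃ Z : σ → Prop, ¬ Z x ∧ (∀ y ∈ W, y ≠ a → y ≠ x → ¬ A a y → Z y) ∧
        ∀ p ∈ W, ∀ q ∈ W, p ≠ a → q ≠ a → p ≠ q → ¬ A p q → (Z p ↔ Z q))
    (W : Finset σ) (a : σ) (ha : a ∈ W) (hb : ∃ b ∈ W, b ≠ a ∧ A a b) :
    ∃ v ∈ W, v ≠ a ∧ A a v ∧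
      ∀ j ∈ W, ∀ k ∈ W, j ≠ v → k ≠ v → j ≠ k → A j k → A v j ∨ A v k := by
  classical
  induction W using Finset.strongInduction generalizing a with
  | H W ih =>
    set U := W.filter fun w => w ≠ a ∧ A a w with hU
    have hUmem : ∀ w, w ∈ U ↔ w ∈ W ∧ w ≠ a ∧ A a w := by simp [hU]
    obtain ⟨B, hB⟩ := (U.powerset.filter fun B => B.Nonempty ∧
      ∀ p ∈ B, ∀ q ∈ U, p ≠ q → ¬ A p q → q ∈ B).exists_minimal ⟨U, by
        obtain ⟨b, hbW, hba, hab⟩ := hb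
        simp only [Finset.mem_filter, Finset.mem_powerset]
        exact ⟨subset_rfl, ⟨b, (hUmem b).2 ⟨hbW, hba, hab⟩⟩, fun _ _ q hq _ _ => hq⟩⟩
    obtain ⟨hBmem, hBmin⟩ := hB
    simp only [Finset.mem_filter, Finset.mem_powerset] at hBmem hBmin
    obtain ⟨hBU, hBne, hBcl⟩ := hBmem
    set S := W.filter fun s => s ∉ U ∧ s ≠ a ∧ ∃ b ∈ B, ¬ A s b with hS
    have hSmem : ∀ s, s ∈ S ↔ s ∈ W ∧ s ∉ U ∧ s ≠ a ∧ ∃ b ∈ B, ¬ A s b := by simp [hS]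
    have hBW : ∀ b ∈ B, b ∈ W ∧ b ≠ a ∧ A a b := fun b hb => (hUmem b).1 (hBU hb)
    have hSa : ∀ s ∈ S, ¬ A a s := by
      intro s hs h
      obtain ⟨h1, h2, h3, -⟩ := (hSmem s).1 hs
      exact h2 ((hUmem s).2 ⟨h1, h3, h⟩)
    have hSclique : ∀ x ∈ S, ∀ y ∈ S, x ≠ y → ¬ A x y := by
      intro x hx y hy hxy hA
      obtain ⟨hxW, hxU, hxa, b, hb, hxb⟩ := (hSmem x).1 hx
      obtain ⟨hyW, hyU, hya, b', hb', hyb'⟩ := (hSmem y).1 hy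
      obtain ⟨Z, hZx, hZy, hZ⟩ := hsep (insert a (insert x (insert y B))) a x (by simp) (by simp)
        hxa.symm (hSa x hx) (by
          intro z hz hza hzx
          simp only [Finset.mem_insert, hza, hzx, false_or] at hz
          rcases hz with rfl | hz
          · exact Or.inr (hsymm _ _ hA)
          · exact Or.inl (hsymm _ _ (hBW z hz).2.2))
      have hZy := hZy y (by simp) hya hxy.symm (hSa y hy)
      have hbx : x ≠ b := fun h => hxU (h ▸ hBU hb)
      have hby : y ≠ b' := fun h => hyU (h ▸ hBU hb')
      have hZb : ¬ Z b := by
        rwa [← hZ x (by simp) b (by simp [hb]) hxa (hBW b hb).2.1 hbx hxb]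
      have hZb' : Z b' := by
        rwa [← hZ y (by simp) b' (by simp [hb']) hya (hBW b' hb').2.1 hby hyb']
      have := hBmin (y := B.filter Z) ⟨(Finset.filter_subset _ _).trans hBU,
        ⟨b', by simp [hb', hZb']⟩, by
          intro p hp q hq hpq hA'
          rw [Finset.mem_filter] at hp ⊢
          have hqB := hBcl p hp.1 q hq hpq hA'
          exact ⟨hqB, (hZ p (by simp [hp.1]) q (by simp [hqB]) (hBW p hp.1).2.1 (hBW q hqB).2.1
            hpq hA').1 hp.2⟩⟩ (Finset.filter_subset _ _) hb
      exact hZb (Finset.mem_filter.1 this).2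
    have hlt : B ∪ S ⊂ W := by
      refine Finset.ssubset_iff_subset_ne.2 ⟨?_, ?_⟩
      · intro w hw
        rcases Finset.mem_union.1 hw with h | h
        · exact (hBW w h).1
        · exact ((hSmem w).1 h).1
      · intro h
        rw [← h] at ha
        rcases Finset.mem_union.1 ha with h | h
        · exact (hBW a h).2.1 rfl
        · exact ((hSmem a).1 h).2.2.1 rfl
    suffices hv : ∃ v ∈ B, ∀ j ∈ B ∪ S, ∀ k ∈ B ∪ S, j ≠ v → k ≠ v → j ≠ k → A j k →
        A v j ∨ A v k by
      obtain ⟨v, hvB, hv⟩ := hv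
      refine ⟨v, (hBW v hvB).1, (hBW v hvB).2.1, (hBW v hvB).2.2, ?_⟩
      have hnb : ∀ j ∈ W, j ≠ v → ¬ A v j → j ∈ B ∪ S := by
        intro j hj hjv hA
        by_cases hjU : j ∈ U
        · exact Finset.mem_union_left _ (hBcl v hvB j hjU hjv.symm hA)
        · refine Finset.mem_union_right _ ((hSmem j).2 ⟨hj, hjU, ?_, v, hvB,
            fun h => hA (hsymm _ _ h)⟩)
          rintro rfl
          exact hA (hsymm _ _ (hBW v hvB).2.2)
      intro j hj k hk hjv hkv hjk hA
      by_contra! hcon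
      have := hv j (hnb j hj hjv hcon.1) k (hnb k hk hkv hcon.2) hjv hkv hjk hA
      tauto
    by_cases h1 : ∃ s ∈ S, ∃ b ∈ B ∪ S, b ≠ s ∧ A s b
    · obtain ⟨s, hs, hsb⟩ := h1
      obtain ⟨v, hv, hvs, hsv, hsimp⟩ := ih _ hlt s (Finset.mem_union_right _ hs) hsb
      rcases Finset.mem_union.1 hv with h | h
      · exact ⟨v, h, hsimp⟩
      · exact absurd hsv (hSclique s hs v h hvs.symm)
    push Not at h1
    by_cases h2 : ∃ s ∈ B, ∃ b ∈ B ∪ S, b ≠ s ∧ A s b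
    · obtain ⟨s, hs, hsb⟩ := h2
      have hsu := Finset.mem_union_left S hs
      obtain ⟨v, hv, hvs, hsv, hsimp⟩ := ih _ hlt s hsu hsb
      rcases Finset.mem_union.1 hv with h | h
      · exact ⟨v, h, hsimp⟩
      · exact absurd (hsymm _ _ hsv) (h1 v h s hsu hvs.symm)
    push Not at h2
    obtain ⟨b, hb⟩ := hBne
    refine ⟨b, hb, fun j hj k hk _ _ hjk hA => absurd hA ?_⟩
    rcases Finset.mem_union.1 hj with h | h
    · exact h2 j h k hk hjk.symm
    · exact h1 j h k hk hjk.symm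

lemma exists_elimination_order (hsymm : ∀ i j, A i j → A j i)
    (hloop : ∀ i j k, A i i → A j k → i ≠ j → i ≠ k → A i j ∨ A i k)
    (hsep : ∀ (W : Finset σ) (a x : σ), a ∈ W → x ∈ W → a ≠ x → ¬ A a x →
      (∀ z ∈ W, z ≠ a → z ≠ x → A z a ∨ A z x) →
      ∃ Z : σ → Prop, ¬ Z x ∧ (∀ y ∈ W, y ≠ a → y ≠ x → ¬ A a y → Z y) ∧
        ∀ p ∈ W, ∀ q ∈ W, p ≠ a → q ≠ a → p ≠ q → ¬ A p q → (Z p ↔ Z q))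
    (W : Finset σ) :
    ∃ ρ : σ → ℕ, Set.InjOn ρ W ∧ ∀ i ∈ W, ∀ j ∈ W, ∀ k ∈ W, ρ i < ρ j → ρ i < ρ k → A j k →
      A i j ∨ A i k := by
  classical
  induction W using Finset.strongInduction with
  | H W ih =>
    rcases W.eq_empty_or_nonempty with rfl | hW
    · exact ⟨fun _ => 0, by simp, by simp⟩
    have hfirst : ∃ i ∈ W, ∀ j ∈ W, ∀ k ∈ W, j ≠ i → k ≠ i → A j k → A i j ∨ A i k := by
      by_cases hl : ∃ i ∈ W, A i i
      · obtain ⟨i, hi, hii⟩ := hl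
        exact ⟨i, hi, fun j _ k _ hj hk hA => hloop i j k hii hA hj.symm hk.symm⟩
      push Not at hl
      by_cases hne : ∃ a ∈ W, ∃ b ∈ W, b ≠ a ∧ A a b
      · obtain ⟨a, ha, hb⟩ := hne
        obtain ⟨v, hv, -, -, hsimp⟩ := exists_simplicial hsymm hsep W a ha hb
        refine ⟨v, hv, fun j hj k hk hjv hkv hA => hsimp j hj k hk hjv hkv ?_ hA⟩
        rintro rfl
        exact hl j hj hA
      push Not at hne
      obtain ⟨i, hi⟩ := hW
      refine ⟨i, hi, fun j hj k hk _ _ hA => ?_⟩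
      by_cases hjk : k = j
      · exact absurd (hjk ▸ hA) (hl j hj)
      · exact absurd hA (hne j hj k hk hjk)
    obtain ⟨i, hi, hfirst⟩ := hfirst
    obtain ⟨ρ, hinj, hρ⟩ := ih _ (Finset.erase_ssubset hi)
    refine ⟨fun x => if x = i then 0 else ρ x + 1, ?_, ?_⟩
    · intro x hx y hy hxy
      by_cases hxi : x = i <;> by_cases hyi : y = i <;> simp [hxi, hyi] at hxy ⊢
      exact hinj (by simpa [hxi] using hx) (by simpa [hyi] using hy) hxy
    · intro x hx j hj k hk hxj hxk hA
      have hji : j ≠ i := by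
        rintro rfl
        simp at hxj
      have hki : k ≠ i := by
        rintro rfl
        simp at hxk
      by_cases hxi : x = i
      · exact hxi ▸ hfirst j hj k hk hji hki hA
      · simp only [hxi, hji, hki, if_false, add_lt_add_iff_right] at hxj hxk
        exact hρ x (Finset.mem_erase.2 ⟨hxi, hx⟩) j (Finset.mem_erase.2 ⟨hji, hj⟩) k
          (Finset.mem_erase.2 ⟨hki, hk⟩) hxj hxk hA

end Elimination

section Exchange

variable {V : Type*} [DecidableEq V]

/-- The indicator function of the vertex `a`. -/
def ind (a v : V) : ℕ := if v = a then 1 else 0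

/-- The number of times `v` is an endpoint of an edge in the multiset `E`. -/
def edgeDeg (E : Multiset (Sym2 V)) (v : V) : ℕ :=
  (E.map (Sym2.lift ⟨fun a b => ind a v + ind b v, fun _ _ => add_comm _ _⟩)).sum

lemma ind_eq_zero_of_apply_ne {α : Type*} (d : V → α) {a v : V} (h : d v ≠ d a) : ind a v = 0 :=
  if_neg fun h' => h (congrArg d h')

lemma edgeDeg_zero (v : V) : edgeDeg 0 v = 0 := rfl

lemma edgeDeg_cons (p q : V) (E : Multiset (Sym2 V)) (v : V) :
    edgeDeg (s(p, q) ::ₘ E) v = ind p v + ind q v + edgeDeg E v := by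
  simp [edgeDeg]

lemma edgeDeg_add (E F : Multiset (Sym2 V)) (v : V) :
    edgeDeg (E + F) v = edgeDeg E v + edgeDeg F v := by
  simp [edgeDeg]

lemma exists_mem_of_edgeDeg_ne_zero {E : Multiset (Sym2 V)} {v : V} (h : edgeDeg E v ≠ 0) :
    ∃ w, s(v, w) ∈ E := by
  induction E using Multiset.induction with
  | empty => exact absurd rfl h
  | cons x E ih =>
    induction x with
    | h p q =>
      rw [edgeDeg_cons] at h
      by_cases hp : v = p
      · exact ⟨q, by simp [hp]⟩
      by_cases hq : v = q
      · exact ⟨p, by simp [hq, Sym2.eq_swap]⟩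
      obtain ⟨w, hw⟩ := ih (by simpa [ind, hp, hq] using h)
      exact ⟨w, Multiset.mem_cons_of_mem hw⟩

lemma edgeDeg_pos_of_mem {E : Multiset (Sym2 V)} {v w : V} (h : s(v, w) ∈ E) :
    0 < edgeDeg E v := by
  obtain ⟨E, rfl⟩ := Multiset.exists_cons_of_mem h
  rw [edgeDeg_cons, ind, if_pos rfl]
  omega

lemma sum_edgeDeg [Fintype V] (d : V → ℕ) (E : Multiset (Sym2 V)) :
    ∑ v, d v * edgeDeg E v =
      (E.map (Sym2.lift ⟨fun a b => d a + d b, fun _ _ => add_comm _ _⟩)).sum := by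
  induction E using Multiset.induction with
  | empty => simp [edgeDeg_zero]
  | cons x E ih =>
    induction x with
    | h p q =>
      simp only [edgeDeg_cons, mul_add, Finset.sum_add_distrib, ih]
      simp [ind]

lemma sum_edgeDeg_eq [Fintype V] (E : Multiset (Sym2 V)) : ∑ v, edgeDeg E v = 2 * E.card := by
  have := sum_edgeDeg (fun _ => 1) E
  simp only [one_mul] at this
  rw [this, Multiset.map_congr rfl (g := fun _ => 2)]
  · simp [mul_comm]
  · intro x _
    induction x with
    | h p q => rfl

lemma edgeDeg_filter (d : V → ℕ) {E : Multiset (Sym2 V)}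
    [DecidablePred fun x : Sym2 V => ∀ v ∈ x, d v = 1]
    (hE : ∀ p q, s(p, q) ∈ E → d p + d q = 2) (v : V) :
    edgeDeg (E.filter fun x => ∀ v ∈ x, d v = 1) v = if d v = 1 then edgeDeg E v else 0 := by
  induction E using Multiset.induction with
  | empty => simp [edgeDeg_zero]
  | cons x E ih =>
    have ih := ih fun p q h => hE p q (Multiset.mem_cons_of_mem h)
    induction x with
    | h p q =>
      have h := hE p q (Multiset.mem_cons_self _ _)
      by_cases hp : d p = 1
      · rw [Multiset.filter_cons_of_pos _ (by simp; omega), edgeDeg_cons, edgeDeg_cons, ih]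
        have h1 : d v ≠ 1 → ind p v = 0 := fun h => ind_eq_zero_of_apply_ne d (by omega)
        have h2 : d v ≠ 1 → ind q v = 0 := fun h => ind_eq_zero_of_apply_ne d (by omega)
        split_ifs with hv
        · rfl
        · rw [h1 hv, h2 hv]
      · rw [Multiset.filter_cons_of_neg _ (by simp [hp]), edgeDeg_cons, ih]
        have h1 : d v = 1 → ind p v = 0 := fun h => ind_eq_zero_of_apply_ne d (by omega)
        have h2 : d v = 1 → ind q v = 0 := fun h => ind_eq_zero_of_apply_ne d (by omega)
        split_ifs with hv
        · rw [h1 hv, h2 hv, zero_add, zero_add]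
        · rfl

/-- The counting argument: under a weighting of the vertices by which edges of `F` have weight at
least two and edges of `E` at most two, all inequalities are equalities. -/
lemma edgeDeg_filter_eq_of_weights [Fintype V] (d : V → ℕ) {E F : Multiset (Sym2 V)}
    [DecidablePred fun x : Sym2 V => ∀ v ∈ x, d v = 1]
    (hcard : E.card = F.card) (hE : ∀ p q, s(p, q) ∈ E → d p + d q ≤ 2)
    (hF : ∀ p q, s(p, q) ∈ F → 2 ≤ d p + d q)
    (hEF : ∀ v, d v ≠ 0 → edgeDeg F v ≤ edgeDeg E v) :
    (∀ p q, s(p, q) ∈ E → d p + d q = 2) ∧ ∀ v,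
      edgeDeg (E.filter fun x => ∀ v ∈ x, d v = 1) v =
        edgeDeg (F.filter fun x => ∀ v ∈ x, d v = 1) v := by
  set D : Sym2 V → ℕ := Sym2.lift ⟨fun a b => d a + d b, fun _ _ => add_comm _ _⟩ with hD
  have hDs : ∀ p q, D s(p, q) = d p + d q := fun _ _ => rfl
  have hE' : ∀ x ∈ E, D x ≤ 2 := by
    intro x hx
    induction x with
    | h p q => exact hE p q hx
  have hF' : ∀ x ∈ F, 2 ≤ D x := by
    intro x hx
    induction x with
    | h p q => exact hF p q hx
  have h1 : (E.map D).sum ≤ 2 * E.card := by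
    have := Multiset.sum_le_card_nsmul (E.map D) 2 (by simpa using hE')
    simpa [mul_comm] using this
  have h2 : 2 * F.card ≤ (F.map D).sum := by
    have := Multiset.card_nsmul_le_sum (s := F.map D) (a := 2) (by simpa using hF')
    simpa [mul_comm] using this
  have h3 : ∀ v ∈ Finset.univ, d v * edgeDeg F v ≤ d v * edgeDeg E v := by
    intro v _
    by_cases hv : d v = 0
    · simp [hv]
    · exact Nat.mul_le_mul_left _ (hEF v hv)
  have h4 := Finset.sum_le_sum h3
  rw [sum_edgeDeg, sum_edgeDeg, ← hD] at h4
  have hEeq : ∀ x ∈ E, D x = 2 := by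
    by_contra! hcon
    obtain ⟨x, hx, hne⟩ := hcon
    have : (E.map D).sum < (E.map fun _ => 2).sum :=
      Multiset.sum_lt_sum hE' ⟨x, hx, lt_of_le_of_ne (hE' x hx) hne⟩
    simp at this
    omega
  have hFeq : ∀ x ∈ F, D x = 2 := by
    by_contra! hcon
    obtain ⟨x, hx, hne⟩ := hcon
    have : (F.map fun _ => 2).sum < (F.map D).sum :=
      Multiset.sum_lt_sum hF' ⟨x, hx, lt_of_le_of_ne (hF' x hx) hne.symm⟩
    simp at this
    omega
  have h5 : ∑ v, d v * edgeDeg F v = ∑ v, d v * edgeDeg E v := by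
    rw [sum_edgeDeg, sum_edgeDeg, ← hD]
    omega
  refine ⟨fun p q h => hEeq _ h, fun v => ?_⟩
  rw [edgeDeg_filter d fun p q h => hEeq _ h, edgeDeg_filter d fun p q h => hFeq _ h]
  split_ifs with hv
  · have := (Finset.sum_eq_sum_iff_of_le h3).1 h5 v (Finset.mem_univ v)
    rw [hv, one_mul, one_mul] at this
    exact this.symm
  · rfl

/-- The combinatorial core of the exchange property. Here `s(a, b)` is the largest edge of `E`, the
multisets `E` and `F` are disjoint, and `small` holds for edges below `s(a, b)`. Either one vertex
can be exchanged against another one, or some parts of `E` and `F` have the same degrees. -/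
lemma exists_exchange_or_edgeDeg_eq [Fintype V] {ρ : V → ℕ} (hρ : Function.Injective ρ)
    {Γ small : Sym2 V → Prop} {y a b : V}
    (hC : ∀ i j k, ρ i < ρ j → ρ i < ρ k → Γ s(j, k) → Γ s(i, j) ∨ Γ s(i, k))
    (hy : ∀ v, ρ y ≤ ρ v) (hyy : ¬ Γ s(y, y)) (hab : ρ a ≤ ρ b)
    (hsmall : ∀ p q, ρ p < ρ a → small s(p, q)) {E F : Multiset (Sym2 V)}
    (hE : ∀ x ∈ E, Γ x) (hF : ∀ x ∈ F, Γ x ∧ small x) (hcard : E.card = F.card)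
    (hdisj : ∀ x ∈ E, x ∉ F) (he : s(a, b) ∈ E)
    (htop : ∀ p q, s(p, q) ∈ E ∨ s(p, q) ∈ F → ρ a ≤ ρ p → ρ a ≤ ρ q → p = a ∨ q = a) :
    (∃ (i j : V) (D N : Multiset (Sym2 V)), edgeDeg E i < edgeDeg F i ∧ j ≠ y ∧ D ≤ E ∧
      s(a, b) ∈ D ∧ (∀ x ∈ N, Γ x ∧ small x) ∧ N.card = D.card ∧
      ∀ v, ind i v + edgeDeg D v = ind j v + edgeDeg N v) ∨
    ∃ D N : Multiset (Sym2 V), D ≤ E ∧ N ≤ F ∧ s(a, b) ∈ D ∧ ∀ v, edgeDeg D v = edgeDeg N v := by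
  classical
  rw [or_iff_not_imp_left]
  intro hno
  have hby : b ≠ y := by
    rintro rfl
    rw [hρ (le_antisymm hab (hy a))] at he
    exact hyy (hE _ he)
  have hay : ∀ i, ρ i < ρ a → a ≠ y := by
    rintro i hi rfl
    exact absurd (hy i) (not_le.2 hi)
  have hCe : ∀ i, ρ i < ρ a → ∃ c d, (∀ v, ind a v + ind b v = ind c v + ind d v) ∧ d ≠ y ∧
      Γ s(i, c) ∧ small s(i, c) := by
    intro i hi
    rcases hC i a b hi (hi.trans_le hab) (hE _ he) with h | h
    · exact ⟨a, b, fun v => rfl, hby, h, hsmall _ _ hi⟩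
    · exact ⟨b, a, fun v => add_comm _ _, hay i hi, h, hsmall _ _ hi⟩
  have hhigh : ∀ i, edgeDeg E i < edgeDeg F i → ρ a ≤ ρ i := by
    intro i hi
    by_contra! hlt
    obtain ⟨c, d, hcd, hd, hΓ, hs⟩ := hCe i hlt
    refine hno ⟨i, d, {s(a, b)}, {s(i, c)}, hi, hd, by simpa using he, by simp,
      by simpa using ⟨hΓ, hs⟩, rfl, fun v => ?_⟩
    have := hcd v
    rw [← Multiset.cons_zero, ← Multiset.cons_zero, edgeDeg_cons, edgeDeg_cons, edgeDeg_zero]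
    omega
  obtain ⟨R, hR⟩ := (Finset.univ.filter fun R : Finset V => (∀ r ∈ R, ρ a ≤ ρ r) ∧
    (∀ i, edgeDeg E i < edgeDeg F i → i ∈ R) ∧ ∀ r ∈ R, ∃ (i : V) (D N : Multiset (Sym2 V)),
      edgeDeg E i < edgeDeg F i ∧ D ≤ E ∧ (∀ d ∈ D, ∃ j g, d = s(j, g) ∧ ρ j < ρ a ∧ g ∈ R) ∧
      (∀ x ∈ N, Γ x ∧ small x) ∧ N.card = D.card ∧
      ∀ v, ind i v + edgeDeg D v = ind r v + edgeDeg N v).exists_maximal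
    ⟨Finset.univ.filter fun i => edgeDeg E i < edgeDeg F i, by
      simp only [Finset.mem_filter, Finset.mem_univ, true_and]
      exact ⟨hhigh, fun _ h => h, fun r hr => ⟨r, 0, 0, hr, Multiset.zero_le _, by simp, by simp,
        rfl, fun v => rfl⟩⟩⟩
  obtain ⟨hRmem, hRmax⟩ := hR
  simp only [Finset.mem_filter, Finset.mem_univ, true_and] at hRmem hRmax
  obtain ⟨hRhigh, hRbase, hRinv⟩ := hRmem
  have hDne : ∀ {D : Multiset (Sym2 V)},
      (∀ d ∈ D, ∃ j g, d = s(j, g) ∧ ρ j < ρ a ∧ g ∈ R) → ∀ {p q}, s(p, q) ∈ D →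
      (ρ p < ρ a ∧ q ∈ R) ∨ (ρ q < ρ a ∧ p ∈ R) := by
    intro D hD p q h
    obtain ⟨j, g, hjg, hj, hg⟩ := hD _ h
    rcases Sym2.eq_iff.1 hjg with ⟨rfl, rfl⟩ | ⟨rfl, rfl⟩
    · exact Or.inl ⟨hj, hg⟩
    · exact Or.inr ⟨hj, hg⟩
  have heD : ∀ {D : Multiset (Sym2 V)},
      (∀ d ∈ D, ∃ j g, d = s(j, g) ∧ ρ j < ρ a ∧ g ∈ R) → s(a, b) ∉ D := by
    intro D hD h
    rcases hDne hD h with h | h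
    · exact lt_irrefl _ h.1
    · exact absurd h.1 (not_lt.2 hab)
  have hRa : ∀ r ∈ R, s(r, a) ∉ F := by
    intro r hr hra
    obtain ⟨i, D, N, hi, hDE, hD, hN, hc, hdeg⟩ := hRinv r hr
    refine hno ⟨i, b, s(a, b) ::ₘ D, s(r, a) ::ₘ N, hi, hby,
      (Multiset.cons_le_of_notMem (heD hD)).2 ⟨he, hDE⟩, by simp, ?_, by simp [hc], fun v => ?_⟩
    · intro x hx
      rcases Multiset.mem_cons.1 hx with rfl | hx
      exacts [hF _ hra, hN x hx]
    · have := hdeg v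
      rw [edgeDeg_cons, edgeDeg_cons]
      omega
  have hfinish : ∀ r ∈ R, ∀ p q, s(r, p) ∈ F → s(p, q) ∈ E → ρ q < ρ a → p ∈ R := by
    intro r hr p q hrp hpq hq
    by_contra hpR
    obtain ⟨i, D, N, hi, hDE, hD, hN, hc, hdeg⟩ := hRinv r hr
    obtain ⟨c, d, hcd, hd, hΓ, hs⟩ := hCe q hq
    have hnot : s(p, q) ∉ D := by
      intro h
      rcases hDne hD h with h | h
      · exact absurd (hRhigh q h.2) (not_le.2 hq)
      · exact hpR h.2
    have hnot' : s(a, b) ∉ s(p, q) ::ₘ D := by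
      intro h
      rcases Multiset.mem_cons.1 h with h | h
      · rcases Sym2.eq_iff.1 h with ⟨rfl, rfl⟩ | ⟨rfl, rfl⟩
        · exact absurd hab (not_le.2 hq)
        · exact lt_irrefl _ hq
      · exact heD hD h
    refine hno ⟨i, d, s(a, b) ::ₘ s(p, q) ::ₘ D, s(r, p) ::ₘ s(q, c) ::ₘ N, hi, hd,
      (Multiset.cons_le_of_notMem hnot').2 ⟨he, (Multiset.cons_le_of_notMem hnot).2 ⟨hpq, hDE⟩⟩,
      by simp, ?_, by simp [hc], fun v => ?_⟩
    · intro x hx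
      rcases Multiset.mem_cons.1 hx with rfl | hx
      · exact hF _ hrp
      rcases Multiset.mem_cons.1 hx with rfl | hx
      exacts [⟨hΓ, hs⟩, hN x hx]
    · have := hdeg v
      have := hcd v
      rw [edgeDeg_cons, edgeDeg_cons, edgeDeg_cons, edgeDeg_cons]
      omega
  have hlow : ∀ r ∈ R, ∀ q, s(r, q) ∈ F → ρ q < ρ a := by
    intro r hr q hrq
    by_contra! hq
    rcases htop r q (Or.inr hrq) (hRhigh r hr) hq with rfl | rfl
    · have hqR : q ∉ R := fun h => hRa q h (by rwa [Sym2.eq_swap])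
      have hEq : edgeDeg E q ≠ 0 := by
        have h1 : ¬ edgeDeg E q < edgeDeg F q := fun h => hqR (hRbase q h)
        have h2 : 0 < edgeDeg F q := edgeDeg_pos_of_mem (w := r) (by rwa [Sym2.eq_swap])
        omega
      obtain ⟨h, hqh⟩ := exists_mem_of_edgeDeg_ne_zero hEq
      have hha : ¬ ρ h < ρ r := fun hlt => hqR (hfinish r hr q h hrq hqh hlt)
      rcases htop q h (Or.inl hqh) hq (not_lt.1 hha) with rfl | rfl
      · exact hqR hr
      · exact hdisj _ hqh (by rwa [Sym2.eq_swap])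
    · exact hRa r hr hrq
  have hclosed : ∀ r ∈ R, ∀ q g, s(r, q) ∈ F → s(q, g) ∈ E → g ∈ R := by
    intro r hr q g hrq hqg
    have hq := hlow r hr q hrq
    have hqR : q ∉ R := fun h => absurd (hRhigh q h) (not_le.2 hq)
    have hg : ρ a ≤ ρ g := by
      by_contra! hlt
      exact hqR (hfinish r hr q g hrq hqg hlt)
    by_contra hgR
    refine hgR (hRmax (y := insert g R) ⟨?_, fun i hi => Finset.mem_insert_of_mem (hRbase i hi), ?_⟩
      (Finset.subset_insert _ _) (Finset.mem_insert_self _ _))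
    · intro r' hr'
      rcases Finset.mem_insert.1 hr' with rfl | hr'
      exacts [hg, hRhigh r' hr']
    · intro r' hr'
      rcases Finset.mem_insert.1 hr' with rfl | hr'
      · obtain ⟨i, D, N, hi, hDE, hD, hN, hc, hdeg⟩ := hRinv r hr
        have hnot : s(q, r') ∉ D := by
          intro h
          rcases hDne hD h with h | h
          exacts [hgR h.2, hqR h.2]
        refine ⟨i, s(q, r') ::ₘ D, s(r, q) ::ₘ N, hi,
          (Multiset.cons_le_of_notMem hnot).2 ⟨hqg, hDE⟩, ?_, ?_, by simp [hc], fun v => ?_⟩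
        · intro x hx
          rcases Multiset.mem_cons.1 hx with rfl | hx
          · exact ⟨q, r', rfl, hq, by simp⟩
          · obtain ⟨j, g, h1, h2, h3⟩ := hD x hx
            exact ⟨j, g, h1, h2, by simp [h3]⟩
        · intro x hx
          rcases Multiset.mem_cons.1 hx with rfl | hx
          exacts [hF _ hrq, hN x hx]
        · have := hdeg v
          rw [edgeDeg_cons, edgeDeg_cons]
          omega
      · obtain ⟨i, D, N, hi, hDE, hD, hrest⟩ := hRinv r' hr'
        refine ⟨i, D, N, hi, hDE, fun x hx => ?_, hrest⟩
        obtain ⟨j, g, h1, h2, h3⟩ := hD x hx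
        exact ⟨j, g, h1, h2, by simp [h3]⟩
  set d : V → ℕ := fun v => if v ∈ R then 0 else if ∃ r ∈ R, s(r, v) ∈ F then 2 else 1 with hd
  have hd0 : ∀ v ∈ R, d v = 0 := fun v hv => by simp [hd, hv]
  have hd2 : ∀ r ∈ R, ∀ q, s(r, q) ∈ F → d q = 2 := by
    intro r hr q hrq
    have hqR : q ∉ R := fun h => absurd (hRhigh q h) (not_le.2 (hlow r hr q hrq))
    simp only [hd, if_neg hqR, if_pos (show ∃ r ∈ R, s(r, q) ∈ F from ⟨r, hr, hrq⟩)]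
  have hd1 : ∀ v, v ∉ R → 1 ≤ d v := by
    intro v hv
    simp only [hd, if_neg hv]
    split_ifs <;> omega
  have hd1' : ∀ v, (¬ ∃ r ∈ R, s(r, v) ∈ F) → d v ≤ 1 := by
    intro v hv
    simp only [hd, if_neg hv]
    split_ifs <;> omega
  obtain ⟨hEeq, hfilter⟩ := edgeDeg_filter_eq_of_weights d hcard
    (by
      intro p q hpq
      have hqp : s(q, p) ∈ E := by rwa [Sym2.eq_swap]
      by_cases hp : ∃ r ∈ R, s(r, p) ∈ F
      · obtain ⟨r, hr, hrp⟩ := hp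
        rw [hd2 r hr p hrp, hd0 q (hclosed r hr p q hrp hpq)]
      by_cases hq : ∃ r ∈ R, s(r, q) ∈ F
      · obtain ⟨r, hr, hrq⟩ := hq
        rw [hd2 r hr q hrq, hd0 p (hclosed r hr q p hrq hqp)]
      have := hd1' p hp
      have := hd1' q hq
      omega)
    (by
      intro p q hpq
      have hqp : s(q, p) ∈ F := by rwa [Sym2.eq_swap]
      by_cases hp : p ∈ R
      · have := hd2 p hp q hpq
        omega
      by_cases hq : q ∈ R
      · have := hd2 q hq p hqp
        omega
      have := hd1 p hp
      have := hd1 q hq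
      omega)
    (by
      intro v hv
      by_contra! hlt
      exact hv (hd0 v (hRbase v hlt)))
  refine ⟨_, _, Multiset.filter_le _ E, Multiset.filter_le _ F, ?_, hfilter⟩
  have h1 := hEeq a b he
  have ha := hd1' a fun ⟨r, hr, h⟩ => lt_irrefl _ (hlow r hr a h)
  have hb := hd1' b fun ⟨r, hr, h⟩ => absurd (hlow r hr b h) (not_lt.2 hab)
  rw [Multiset.mem_filter]
  refine ⟨he, fun v hv => ?_⟩
  rcases Sym2.mem_iff.1 hv with rfl | rfl <;> omega

lemma exists_edge_key {V : Type*} [Fintype V] {ρ : V → ℕ} (hρ : Function.Injective ρ) :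
    ∃ key : Sym2 V → ℕ, Function.Injective key ∧
      (∀ a b p q, ρ a ≤ ρ b → ρ p < ρ a → key s(p, q) < key s(a, b)) ∧
      ∀ a b p q, ρ a ≤ ρ b → ρ a ≤ ρ p → ρ a ≤ ρ q → key s(p, q) ≤ key s(a, b) →
        p = a ∨ q = a := by
  obtain ⟨M, hM⟩ : ∃ M, ∀ v, ρ v < M :=
    ⟨∑ v, ρ v + 1, fun v => Nat.lt_succ_of_le
      (Finset.single_le_sum (fun _ _ => Nat.zero_le _) (Finset.mem_univ v))⟩
  have hstep : ∀ {m m' t t' : ℕ}, t < M → m < m' → m * M + t < m' * M + t' := by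
    intro m m' t t' ht hm
    have := Nat.mul_le_mul_right M (Nat.succ_le_of_lt hm)
    rw [Nat.succ_mul] at this
    omega
  refine ⟨Sym2.lift ⟨fun p q => min (ρ p) (ρ q) * M + max (ρ p) (ρ q),
    fun p q => by beta_reduce; rw [min_comm, max_comm]⟩, ?_, ?_, ?_⟩
  · intro x x'
    induction x with
    | h p q =>
      induction x' with
      | h p' q' =>
        intro h
        simp only [Sym2.lift_mk] at h
        have h1 : max (ρ p) (ρ q) < M := max_lt (hM p) (hM q)
        have h2 : max (ρ p') (ρ q') < M := max_lt (hM p') (hM q')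
        rcases lt_trichotomy (min (ρ p) (ρ q)) (min (ρ p') (ρ q')) with hlt | heq | hlt
        · exact absurd h (hstep h1 hlt).ne
        · rw [heq, Nat.add_left_cancel_iff] at h
          have : (ρ p = ρ p' ∧ ρ q = ρ q') ∨ (ρ p = ρ q' ∧ ρ q = ρ p') := by omega
          rw [Sym2.eq_iff]
          simpa only [hρ.eq_iff] using this
        · exact absurd h (hstep h2 hlt).ne'
  · intro a b p q hab hpa
    simp only [Sym2.lift_mk]
    exact hstep (max_lt (hM p) (hM q)) (by omega)
  · intro a b p q hab hp hq
    contrapose!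
    intro h
    simp only [Sym2.lift_mk]
    refine hstep (max_lt (hM a) (hM b)) ?_
    have h1 : ρ p ≠ ρ a := hρ.ne h.1
    have h2 : ρ q ≠ ρ a := hρ.ne h.2
    omega

/-- The weight of a multiset of edges, each edge `x` contributing `B ^ key x`. -/
def edgeWeight (key : Sym2 V → ℕ) (B : ℕ) (E : Multiset (Sym2 V)) : ℕ :=
  (E.map fun x => B ^ key x).sum

lemma edgeWeight_add {V : Type*} (key : Sym2 V → ℕ) (B : ℕ) (E F : Multiset (Sym2 V)) :
    edgeWeight key B (E + F) = edgeWeight key B E + edgeWeight key B F := by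
  simp [edgeWeight]

lemma pow_le_edgeWeight {V : Type*} (key : Sym2 V → ℕ) (B : ℕ) {E : Multiset (Sym2 V)} {x : Sym2 V}
    (hx : x ∈ E) : B ^ key x ≤ edgeWeight key B E :=
  Multiset.single_le_sum (fun _ _ => Nat.zero_le _) _
    (Multiset.mem_map_of_mem (fun x => B ^ key x) hx)

lemma edgeWeight_lt_pow {V : Type*} {key : Sym2 V → ℕ} {B : ℕ} {N : Multiset (Sym2 V)} {t : ℕ}
    (hN : ∀ x ∈ N, key x < t) (hcard : N.card < B) : edgeWeight key B N < B ^ t := by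
  rcases N.empty_or_exists_mem with rfl | ⟨x, hx⟩
  · simpa [edgeWeight] using Nat.pow_pos (n := t) (by omega : 0 < B)
  obtain ⟨t, rfl⟩ : ∃ t', t = t' + 1 := ⟨t - 1, by have := hN x hx; omega⟩
  have h : edgeWeight key B N ≤ N.card * B ^ t := by
    have := Multiset.sum_le_card_nsmul (N.map fun x => B ^ key x) (B ^ t) (by
      simp only [Multiset.mem_map, forall_exists_index, and_imp, forall_apply_eq_imp_iff₂]
      exact fun x hx => Nat.pow_le_pow_right (by omega) (Nat.le_of_lt_succ (hN x hx)))
    simpa [edgeWeight] using this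
  refine h.trans_lt ?_
  rw [pow_succ, mul_comm]
  exact Nat.mul_lt_mul_of_pos_left hcard (Nat.pow_pos (by omega))

lemma exists_exchange [Fintype V] {ρ : V → ℕ} (hρ : Function.Injective ρ)
    {Γ : Sym2 V → Prop} {y : V}
    (hC : ∀ i j k, ρ i < ρ j → ρ i < ρ k → Γ s(j, k) → Γ s(i, j) ∨ Γ s(i, k))
    (hy : ∀ v, ρ y ≤ ρ v) (hyy : ¬ Γ s(y, y)) {key : Sym2 V → ℕ} (hkey : Function.Injective key)
    (hlow : ∀ a b p q, ρ a ≤ ρ b → ρ p < ρ a → key s(p, q) < key s(a, b))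
    (htop : ∀ a b p q, ρ a ≤ ρ b → ρ a ≤ ρ p → ρ a ≤ ρ q → key s(p, q) ≤ key s(a, b) →
      p = a ∨ q = a)
    {E F : Multiset (Sym2 V)} {B : ℕ} (hE : ∀ x ∈ E, Γ x) (hF : ∀ x ∈ F, Γ x)
    (hcard : E.card = F.card) (hB : E.card < B) (hne : E ≠ F)
    (hwt : edgeWeight key B F ≤ edgeWeight key B E)
    (hmin : ∀ E' : Multiset (Sym2 V), (∀ x ∈ E', Γ x) → (∀ v, edgeDeg E' v = edgeDeg E v) →
      edgeWeight key B E ≤ edgeWeight key B E') :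
    ∃ (i j : V) (E' : Multiset (Sym2 V)), edgeDeg E i < edgeDeg F i ∧ j ≠ y ∧ (∀ x ∈ E', Γ x) ∧
      E'.card = E.card ∧ edgeWeight key B E' < edgeWeight key B E ∧
      ∀ v, ind i v + edgeDeg E v = ind j v + edgeDeg E' v := by
  obtain ⟨E₀, F₀, C, rfl, rfl, hdisj⟩ : ∃ E₀ F₀ C, E = E₀ + C ∧ F = F₀ + C ∧
      ∀ x ∈ E₀, x ∉ F₀ := by
    refine ⟨E - F, F - E, E ∩ F, (Multiset.sub_add_inter E F).symm, ?_, ?_⟩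
    · rw [Multiset.inter_comm, Multiset.sub_add_inter]
    · intro x hx hx'
      rw [Multiset.mem_sub] at hx hx'
      omega
  have hne0 : E₀.toFinset.Nonempty := by
    rw [Multiset.toFinset_nonempty]
    rintro rfl
    refine hne ?_
    simp only [Multiset.card_add, Multiset.card_zero] at hcard
    rw [Multiset.card_eq_zero.1 (by omega : F₀.card = 0)]
  obtain ⟨e, heE, hemax⟩ := E₀.toFinset.exists_max_image key hne0
  simp only [Multiset.mem_toFinset] at heE hemax
  obtain ⟨a, b, hab, rfl⟩ : ∃ a b, ρ a ≤ ρ b ∧ e = s(a, b) := by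
    induction e with
    | h p q =>
      rcases le_total (ρ p) (ρ q) with h | h
      · exact ⟨p, q, h, rfl⟩
      · exact ⟨q, p, h, Sym2.eq_swap⟩
  simp only [Multiset.card_add, edgeWeight_add, add_le_add_iff_right, add_left_inj] at *
  have hFsmall : ∀ x ∈ F₀, key x < key s(a, b) := by
    intro x hx
    by_contra! hle
    have hlt : key s(a, b) < key x := lt_of_le_of_ne hle fun h => hdisj _ heE (hkey h ▸ hx)
    have h1 := pow_le_edgeWeight key B hx
    have h2 : edgeWeight key B E₀ < B ^ key x :=
      edgeWeight_lt_pow (fun x hx => (hemax x hx).trans_lt hlt) (by omega)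
    omega
  have hE₀ : ∀ x ∈ E₀, Γ x := fun x hx => hE x (Multiset.mem_add.2 (Or.inl hx))
  have hCΓ : ∀ x ∈ C, Γ x := fun x hx => hE x (Multiset.mem_add.2 (Or.inr hx))
  have hF₀ : ∀ x ∈ F₀, Γ x := fun x hx => hF x (Multiset.mem_add.2 (Or.inl hx))
  have hrepl : ∀ D N : Multiset (Sym2 V), D ≤ E₀ → s(a, b) ∈ D →
      (∀ x ∈ N, Γ x ∧ key x < key s(a, b)) → N.card = D.card →
      ∃ L, E₀ = L + D ∧ (∀ x ∈ L + N + C, Γ x) ∧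
        edgeWeight key B (L + N + C) < edgeWeight key B E₀ + edgeWeight key B C := by
    intro D N hD he hN hc
    obtain ⟨L, rfl⟩ := Multiset.le_iff_exists_add.1 hD
    refine ⟨L, add_comm _ _, ?_, ?_⟩
    · intro x hx
      simp only [Multiset.mem_add] at hx hE₀
      rcases hx with (hx | hx) | hx
      exacts [hE₀ x (Or.inr hx), (hN x hx).1, hCΓ x hx]
    · have h1 := pow_le_edgeWeight key B he
      have h2 : edgeWeight key B N < B ^ key s(a, b) :=
        edgeWeight_lt_pow (fun x hx => (hN x hx).2) (by rw [Multiset.card_add] at hB; omega)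
      simp only [edgeWeight_add]
      omega
  rcases exists_exchange_or_edgeDeg_eq hρ (Γ := Γ) (small := fun x => key x < key s(a, b)) hC hy
    hyy hab (fun p q hp => hlow a b p q hab hp) hE₀ (fun x hx => ⟨hF₀ x hx, hFsmall x hx⟩) hcard
    hdisj heE (fun p q h hp hq => htop a b p q hab hp hq
      (h.elim (hemax _) fun h => (hFsmall _ h).le)) with
    ⟨i, j, D, N, hi, hj, hD, he, hN, hc, hdeg⟩ | ⟨D, N, hD, hNF, he, hdeg⟩
  · obtain ⟨L, rfl, hL, hw⟩ := hrepl D N hD he hN hc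
    refine ⟨i, j, L + N + C, ?_, hj, hL, by simp [hc], hw, fun v => ?_⟩
    · simp only [edgeDeg_add] at hi ⊢
      omega
    · have := hdeg v
      simp only [edgeDeg_add]
      omega
  · obtain ⟨L, rfl, hL, hw⟩ := hrepl D N hD he
      (fun x hx => ⟨hF₀ x (Multiset.mem_of_le hNF hx), hFsmall x (Multiset.mem_of_le hNF hx)⟩) (by
        have h1 := sum_edgeDeg_eq D
        have h2 := sum_edgeDeg_eq N
        simp only [hdeg] at h1
        omega)
    refine absurd (hmin _ hL fun v => ?_) (not_le.2 hw)
    simp only [edgeDeg_add, hdeg]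

end Exchange

lemma hasLinearQuotients_of_exchange {K : Type*} [Field K] {n : ℕ} (𝒰 : Finset (Fin n →₀ ℕ))
    (d : ℕ) (hd : ∀ U ∈ 𝒰, U.degree = d) (w : (Fin n →₀ ℕ) → ℕ)
    (hex : ∀ U ∈ 𝒰, ∀ U' ∈ 𝒰, U ≠ U' → w U' ≤ w U → ∃ p ∈ 𝒰, w p < w U ∧
      ∃ i j, U i < U' i ∧ p + Finsupp.single j 1 = U + Finsupp.single i 1) :
    HasLinearQuotients (Ideal.span ((fun U => monomial U (1 : K)) ''
      (𝒰 : Set (Fin n →₀ ℕ)))) := by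
  set f : Fin 𝒰.card → (Fin n →₀ ℕ) := fun i => (𝒰.equivFin.symm i : Fin n →₀ ℕ) with hf
  set u : Fin 𝒰.card → (Fin n →₀ ℕ) := f ∘ Tuple.sort (w ∘ f) with hu
  have hmono : ∀ {i j}, i ≤ j → w (u i) ≤ w (u j) := fun h => Tuple.monotone_sort (w ∘ f) h
  have hinj : Function.Injective u :=
    (Subtype.val_injective.comp 𝒰.equivFin.symm.injective).comp (Equiv.injective _)
  have hmem : ∀ i, u i ∈ 𝒰 := fun i => (𝒰.equivFin.symm _).2
  have hsurj : ∀ U ∈ 𝒰, ∃ i, u i = U := fun U hU =>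
    ⟨(Tuple.sort (w ∘ f)).symm (𝒰.equivFin ⟨U, hU⟩), by simp [hu, hf]⟩
  refine ⟨𝒰.card, u, ?_, ?_, ?_⟩
  · intro i j hij
    refine hinj ?_
    obtain ⟨c, hc⟩ := le_iff_exists_add.1 hij
    have h1 := congrArg Finsupp.degree hc
    rw [map_add, hd _ (hmem i), hd _ (hmem j)] at h1
    have h2 : c = 0 := (Finsupp.degree_eq_zero_iff c).1 (by omega)
    rw [hc, h2, add_zero]
  · congr 1
    ext p
    constructor
    · rintro ⟨U, hU, rfl⟩
      obtain ⟨i, rfl⟩ := hsurj U hU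
      exact ⟨i, rfl⟩
    · rintro ⟨i, rfl⟩
      exact ⟨u i, hmem i, rfl⟩
  · intro t
    refine ⟨{i | ∃ j < t, ∃ q, u j + Finsupp.single q 1 = u t + Finsupp.single i 1}, ?_⟩
    rw [← Set.image_image (fun U => monomial U (1 : K)) u]
    apply le_antisymm
    · intro p h
      rw [Ideal.mem_colon_span_singleton, mem_ideal_span_monomial_image] at h
      refine mem_ideal_span_X_image.2 fun e he => ?_
      have hs : e + u t ∈ (p * monomial (u t) 1).support := by
        rw [mem_support_iff, coeff_mul_monomial, mul_one]
        exact mem_support_iff.1 he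
      obtain ⟨_, ⟨j, hj, rfl⟩, hle⟩ := h _ hs
      obtain ⟨p, hp, hlt, i, q, hi, hpq⟩ := hex (u t) (hmem t) (u j) (hmem j)
        (fun h => (hinj h).not_gt hj) (hmono (le_of_lt hj))
      obtain ⟨j', rfl⟩ := hsurj p hp
      refine ⟨i, ⟨j', ?_, q, hpq⟩, ?_⟩
      · by_contra! h
        exact absurd (hmono h) (not_le.2 hlt)
      · have := hle i
        rw [Finsupp.add_apply] at this
        omega
    · refine Ideal.span_le.2 ?_
      rintro _ ⟨i, ⟨j, hj, q, hq⟩, rfl⟩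
      rw [SetLike.mem_coe, Ideal.mem_colon_span_singleton]
      beta_reduce
      rw [X, monomial_mul, one_mul, add_comm, ← hq]
      exact monomial_mem_of_le le_self_add (Ideal.subset_span ⟨u j, ⟨j, hj, rfl⟩, rfl⟩)

section Presentation

variable {K : Type*} [Field K] {n : ℕ}

/-- The edges of the graph attached to `I` and `P`: the vertex `none` is joined to the variables
in `P`, the other edges are the quadratic monomials in `I`. -/
def IsEdge (A : Fin n → Fin n → Prop) (s : Set (Fin n)) (x : Sym2 (Option (Fin n))) : Prop :=
  (∃ i j, A i j ∧ x = s(some i, some j)) ∨ ∃ i ∈ s, x = s(none, some i)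

/-- `E` presents `x^U` as a product of `k` variables in `P` and `l` quadratic monomials in `I`. -/
def Presents (A : Fin n → Fin n → Prop) (s : Set (Fin n)) (k l : ℕ) (U : Fin n →₀ ℕ)
    (E : Multiset (Sym2 (Option (Fin n)))) : Prop :=
  (∀ x ∈ E, IsEdge A s x) ∧ E.card = k + l ∧ edgeDeg E none = k ∧ ∀ i, edgeDeg E (some i) = U i

lemma isEdge_some_some {A : Fin n → Fin n → Prop} (hsymm : ∀ i j, A i j → A j i) {s : Set (Fin n)}
    {i j : Fin n} : IsEdge A s s(some i, some j) ↔ A i j := by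
  constructor
  · rintro (⟨i', j', h, heq⟩ | ⟨i', -, heq⟩)
    · rcases Sym2.eq_iff.1 heq with ⟨h1, h2⟩ | ⟨h1, h2⟩ <;> cases h1 <;> cases h2
      exacts [h, hsymm _ _ h]
    · simp at heq
  · exact fun h => Or.inl ⟨i, j, h, rfl⟩

lemma isEdge_none_some {A : Fin n → Fin n → Prop} {s : Set (Fin n)} {i : Fin n} :
    IsEdge A s s(none, some i) ↔ i ∈ s := by
  constructor
  · rintro (⟨i', j', h, heq⟩ | ⟨i', h, heq⟩)
    · simp at heq
    · simp at heq
      exact heq ▸ h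
  · exact fun h => Or.inr ⟨i, h, rfl⟩

lemma not_isEdge_none_none {A : Fin n → Fin n → Prop} {s : Set (Fin n)} :
    ¬ IsEdge A s s(none, none) := by
  rintro (⟨i', j', h, heq⟩ | ⟨i', h, heq⟩) <;> simp at heq

lemma ind_some_some (i j : Fin n) : ind (some i) (some j) = Finsupp.single i 1 j := by
  simp [ind, Finsupp.single_apply, eq_comm]

lemma ind_some_none (i : Fin n) : ind (some i) none = 0 := rfl

lemma ind_none_some (i : Fin n) : ind none (some i) = 0 := rfl

lemma ind_none_none : ind (none : Option (Fin n)) none = 1 := rfl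

lemma Presents.degree {A : Fin n → Fin n → Prop} {s : Set (Fin n)} {k l : ℕ} {U : Fin n →₀ ℕ}
    {E : Multiset (Sym2 (Option (Fin n)))} (h : Presents A s k l U E) : U.degree = k + 2 * l := by
  have h1 := sum_edgeDeg_eq E
  rw [Fintype.sum_option, h.2.2.1, h.2.1] at h1
  simp only [h.2.2.2] at h1
  rw [Finsupp.degree_eq_sum]
  omega

lemma presents_zero {A : Fin n → Fin n → Prop} {s : Set (Fin n)} : Presents A s 0 0 0 0 :=
  ⟨by simp, rfl, rfl, fun _ => rfl⟩

lemma Presents.cons_none_some {A : Fin n → Fin n → Prop} {s : Set (Fin n)} {k l : ℕ}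
    {U : Fin n →₀ ℕ} {E : Multiset (Sym2 (Option (Fin n)))} (h : Presents A s k l U E) {i : Fin n}
    (hi : i ∈ s) : Presents A s (k + 1) l (Finsupp.single i 1 + U) (s(none, some i) ::ₘ E) := by
  obtain ⟨h1, h2, h3, h4⟩ := h
  refine ⟨?_, by rw [Multiset.card_cons]; omega, ?_, fun j => ?_⟩
  · intro x hx
    rcases Multiset.mem_cons.1 hx with rfl | hx
    exacts [isEdge_none_some.2 hi, h1 x hx]
  · rw [edgeDeg_cons, ind_none_none, ind_some_none]
    omega
  · rw [edgeDeg_cons, ind_none_some, ind_some_some, h4, Finsupp.add_apply, zero_add]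

lemma Presents.cons_some_some {A : Fin n → Fin n → Prop} {s : Set (Fin n)} {k l : ℕ}
    {U : Fin n →₀ ℕ} {E : Multiset (Sym2 (Option (Fin n)))} (h : Presents A s k l U E)
    {i j : Fin n} (hij : A i j) : Presents A s k (l + 1)
      (Finsupp.single i 1 + Finsupp.single j 1 + U) (s(some i, some j) ::ₘ E) := by
  obtain ⟨h1, h2, h3, h4⟩ := h
  refine ⟨?_, by rw [Multiset.card_cons]; omega, ?_, fun j => ?_⟩
  · intro x hx
    rcases Multiset.mem_cons.1 hx with rfl | hx
    exacts [Or.inl ⟨i, j, hij, rfl⟩, h1 x hx]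
  · rw [edgeDeg_cons, ind_some_none, ind_some_none]
    omega
  · rw [edgeDeg_cons, ind_some_some, ind_some_some, h4, Finsupp.add_apply, Finsupp.add_apply]

lemma edgeDeg_none_le_card {A : Fin n → Fin n → Prop} {s : Set (Fin n)}
    {E : Multiset (Sym2 (Option (Fin n)))} (hE : ∀ x ∈ E, IsEdge A s x) :
    edgeDeg E none ≤ E.card := by
  induction E using Multiset.induction with
  | empty => exact le_rfl
  | cons x E ih =>
    have := ih fun x hx => hE x (Multiset.mem_cons_of_mem hx)
    rw [Multiset.card_cons]
    rcases hE x (Multiset.mem_cons_self _ _) with ⟨i, j, -, rfl⟩ | ⟨i, -, rfl⟩ <;>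
    · simp only [edgeDeg_cons, ind_some_none, ind_none_none]
      omega

lemma Presents.monomial_mem {A : Fin n → Fin n → Prop} {s : Set (Fin n)}
    {I P : Ideal (MvPolynomial (Fin n) K)}
    (hI : ∀ i j, A i j → monomial (Finsupp.single i 1 + Finsupp.single j 1) (1 : K) ∈ I)
    (hP : ∀ i ∈ s, (X i : MvPolynomial (Fin n) K) ∈ P) {k l : ℕ}
    {U : Fin n →₀ ℕ} {E : Multiset (Sym2 (Option (Fin n)))} (h : Presents A s k l U E) :
    monomial U (1 : K) ∈ P ^ k * I ^ l := by
  induction E using Multiset.induction generalizing k l U with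
  | empty =>
    have h2 := h.2.1
    have hk : k = 0 := by simp at h2; omega
    have hl : l = 0 := by simp at h2; omega
    subst hk hl
    simp
  | cons x E ih =>
    obtain ⟨h1, h2, h3, h4⟩ := h
    have hE : ∀ x ∈ E, IsEdge A s x := fun x hx => h1 x (Multiset.mem_cons_of_mem hx)
    rw [Multiset.card_cons] at h2
    rcases h1 x (Multiset.mem_cons_self _ _) with ⟨i, j, hij, rfl⟩ | ⟨i, hi, rfl⟩
    · simp only [edgeDeg_cons, ind_some_none, ind_some_some, zero_add] at h3 h4
      have hle := edgeDeg_none_le_card hE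
      obtain ⟨l, rfl⟩ : ∃ l', l = l' + 1 := ⟨l - 1, by omega⟩
      set U' : Fin n →₀ ℕ := Finsupp.equivFunOnFinite.symm fun i => edgeDeg E (some i) with hU'
      have hU : U = Finsupp.single i 1 + Finsupp.single j 1 + U' := by
        ext m
        simp [← h4, hU']
      have := Ideal.mul_mem_mul (ih (U := U') (k := k) (l := l)
        ⟨hE, by omega, h3, fun i => by simp [hU']⟩) (hI i j hij)
      rw [mul_assoc, ← pow_succ, monomial_mul, one_mul, add_comm U', ← hU] at this
      exact this
    · simp only [edgeDeg_cons, ind_some_none, ind_some_some, ind_none_some, ind_none_none, zero_add,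
        add_zero] at h3 h4
      obtain ⟨k, rfl⟩ : ∃ k', k = k' + 1 := ⟨k - 1, by omega⟩
      set U' : Fin n →₀ ℕ := Finsupp.equivFunOnFinite.symm fun i => edgeDeg E (some i) with hU'
      have hU : U = Finsupp.single i 1 + U' := by
        ext m
        simp [← h4, hU']
      have := Ideal.mul_mem_mul (hP i hi)
        (ih (U := U') (k := k) (l := l) ⟨hE, by omega, by omega, fun i => by simp [hU']⟩)
      rw [← mul_assoc, ← pow_succ', X, monomial_mul, one_mul, ← hU] at this
      exact this

lemma mul_span_monomial_le {σ R : Type*} [CommSemiring R] {S T W : Set (σ →₀ ℕ)}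
    (h : ∀ a ∈ S, ∀ b ∈ T, a + b ∈ W) :
    Ideal.span ((fun a => monomial a (1 : R)) '' S) * Ideal.span ((fun a => monomial a 1) '' T) ≤
      Ideal.span ((fun a => monomial a 1) '' W) := by
  rw [Ideal.span_mul_span', Ideal.span_le]
  rintro _ ⟨_, ⟨a, ha, rfl⟩, _, ⟨b, hb, rfl⟩, rfl⟩
  exact Ideal.subset_span ⟨a + b, h a ha b hb, by simp [monomial_mul]⟩

lemma pow_mul_pow_eq_span {A : Fin n → Fin n → Prop} {s : Set (Fin n)}
    {I P : Ideal (MvPolynomial (Fin n) K)}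
    (hI : I = Ideal.span ((fun a => monomial a (1 : K)) ''
      {a | ∃ i j, A i j ∧ a = Finsupp.single i 1 + Finsupp.single j 1}))
    (hP : P = Ideal.span ((fun a => monomial a (1 : K)) ''
      {a | ∃ i ∈ s, a = Finsupp.single i 1})) (k l : ℕ) :
    P ^ k * I ^ l =
      Ideal.span ((fun a => monomial a (1 : K)) '' {U | ∃ E, Presents A s k l U E}) := by
  apply le_antisymm
  · induction k with
    | zero =>
      rw [pow_zero, one_mul]
      induction l with
      | zero =>
        intro p _
        have : monomial (0 : Fin n →₀ ℕ) (1 : K) ∈ Ideal.span ((fun a => monomial a (1 : K)) ''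
            {U | ∃ E, Presents A s 0 0 U E}) := Ideal.subset_span ⟨0, ⟨0, presents_zero⟩, rfl⟩
        simpa using Ideal.mul_mem_left _ p this
      | succ l ih =>
        rw [pow_succ']
        refine (Ideal.mul_mono_right ih).trans ?_
        rw [hI]
        refine mul_span_monomial_le ?_
        rintro _ ⟨i, j, hij, rfl⟩ U ⟨E, hE⟩
        exact ⟨_, hE.cons_some_some hij⟩
    | succ k ih =>
      rw [pow_succ', mul_assoc]
      refine (Ideal.mul_mono_right ih).trans ?_
      rw [hP]
      refine mul_span_monomial_le ?_
      rintro _ ⟨i, hi, rfl⟩ U ⟨E, hE⟩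
      exact ⟨_, hE.cons_none_some hi⟩
  · rw [Ideal.span_le]
    rintro _ ⟨U, ⟨E, hE⟩, rfl⟩
    refine hE.monomial_mem (fun i j hij => ?_) fun i hi => ?_
    · exact hI ▸ Ideal.subset_span ⟨_, ⟨i, j, hij, rfl⟩, rfl⟩
    · exact hP ▸ Ideal.subset_span ⟨_, ⟨i, hi, rfl⟩, rfl⟩

lemma exists_finset_presents (A : Fin n → Fin n → Prop) (s : Set (Fin n)) (k l : ℕ) :
    ∃ 𝒰 : Finset (Fin n →₀ ℕ), ∀ U, U ∈ 𝒰 ↔ ∃ E, Presents A s k l U E := by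
  have hfin : {U : Fin n →₀ ℕ | ∃ E, Presents A s k l U E}.Finite := by
    refine (Set.finite_Iic (Finsupp.equivFunOnFinite.symm fun _ => k + 2 * l)).subset ?_
    intro U hU i
    obtain ⟨E, hE⟩ : ∃ E, Presents A s k l U E := hU
    exact (Finsupp.le_degree i U).trans hE.degree.le
  exact ⟨hfin.toFinset, by simp⟩

lemma presents_exchange {A : Fin n → Fin n → Prop} (hsymm : ∀ i j, A i j → A j i)
    {s : Set (Fin n)} (hs : ∀ i j, A i j → i ∈ s ∨ j ∈ s) {ρ : Fin n → ℕ}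
    (hρ : Function.Injective ρ)
    (hC : ∀ i j k, ρ i < ρ j → ρ i < ρ k → A j k → A i j ∨ A i k) (k l : ℕ) :
    ∃ w : (Fin n →₀ ℕ) → ℕ, ∀ U, (∃ E, Presents A s k l U E) → ∀ U',
      (∃ E, Presents A s k l U' E) → U ≠ U' → w U' ≤ w U →
      ∃ p, (∃ E, Presents A s k l p E) ∧ w p < w U ∧
        ∃ i j, U i < U' i ∧ p + Finsupp.single j 1 = U + Finsupp.single i 1 := by
  set ρ' : Option (Fin n) → ℕ := fun v => v.elim 0 fun i => ρ i + 1 with hρ'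
  have hρinj : Function.Injective ρ' := by
    rintro (_ | i) (_ | j) h
    · rfl
    · simp [hρ'] at h
    · simp [hρ'] at h
    · exact congrArg some (hρ (by simpa [hρ'] using h))
  have hCΓ : ∀ i j k, ρ' i < ρ' j → ρ' i < ρ' k → IsEdge A s s(j, k) →
      IsEdge A s s(i, j) ∨ IsEdge A s s(i, k) := by
    rintro i (_ | j) (_ | k) hj hk h
    · simp [hρ'] at hj
    · simp [hρ'] at hj
    · simp [hρ'] at hk
    rw [isEdge_some_some hsymm] at h
    rcases i with _ | i
    · simpa only [isEdge_none_some] using hs j k h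
    · simp only [isEdge_some_some hsymm]
      exact hC i j k (by simpa [hρ'] using hj) (by simpa [hρ'] using hk) h
  obtain ⟨key, hkey, hlow, htop⟩ := exists_edge_key hρinj
  set wt : Multiset (Sym2 (Option (Fin n))) → ℕ := edgeWeight key (k + l + 1) with hwt
  refine ⟨fun U => sInf (wt '' {E | Presents A s k l U E}), ?_⟩
  intro U hU U' hU' hne hle
  have hatt : ∀ U, (∃ E, Presents A s k l U E) → ∃ E, Presents A s k l U E ∧
      wt E = sInf (wt '' {E | Presents A s k l U E}) := fun U hU =>
    Nat.sInf_mem (Set.Nonempty.image wt (s := {E | Presents A s k l U E}) hU)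
  obtain ⟨E, hE, hEw⟩ := hatt U hU
  obtain ⟨F, hF, hFw⟩ := hatt U' hU'
  have hmin : ∀ {U E}, Presents A s k l U E → sInf (wt '' {E | Presents A s k l U E}) ≤ wt E :=
    fun h => Nat.sInf_le ⟨_, h, rfl⟩
  beta_reduce at hle
  rw [← hEw, ← hFw] at hle
  obtain ⟨i, j, E', hi, hj, hE', hcard, hlt, hdeg⟩ := exists_exchange hρinj (y := none) hCΓ
    (fun v => Nat.zero_le _) not_isEdge_none_none hkey hlow htop hE.1 hF.1
    (hE.2.1.trans hF.2.1.symm) (B := k + l + 1) (by rw [hE.2.1]; omega)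
    (by
      rintro rfl
      exact hne (Finsupp.ext fun i => (hE.2.2.2 i).symm.trans (hF.2.2.2 i))) hle
    (by
      intro E' hE' hdeg
      refine hEw.le.trans (hmin ⟨hE', ?_, (hdeg _).trans hE.2.2.1,
        fun i => (hdeg _).trans (hE.2.2.2 i)⟩)
      have h1 := sum_edgeDeg_eq E'
      have h2 := sum_edgeDeg_eq E
      have h3 := hE.2.1
      simp only [hdeg] at h1
      omega)
  rcases i with _ | i
  · rw [hE.2.2.1, hF.2.2.1] at hi
    exact absurd hi (lt_irrefl _)
  rcases j with _ | j
  · exact absurd rfl hj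
  set p : Fin n →₀ ℕ := Finsupp.equivFunOnFinite.symm fun i => edgeDeg E' (some i) with hp
  have hpres : Presents A s k l p E' := by
    refine ⟨hE', hcard.trans hE.2.1, ?_, fun i => by simp [hp]⟩
    have := hdeg none
    rw [ind_some_none, ind_some_none, hE.2.2.1] at this
    omega
  refine ⟨p, ⟨E', hpres⟩, ((hmin hpres).trans_lt hlt).trans_eq hEw, i, j, ?_, ?_⟩
  · rwa [hE.2.2.2, hF.2.2.2] at hi
  · ext v
    have := hdeg (some v)
    rw [ind_some_some, ind_some_some, hE.2.2.2, hpres.2.2.2] at this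
    rw [Finsupp.add_apply, Finsupp.add_apply]
    omega

end Presentation

lemma exists_eq_single_add_single {σ : Type*} {a : σ →₀ ℕ} (ha : a.degree = 2) :
    ∃ i j, a = Finsupp.single i 1 + Finsupp.single j 1 := by
  classical
  have hpeel : ∀ (a : σ →₀ ℕ) (d : ℕ), a.degree = d + 1 →
      ∃ i b, a = Finsupp.single i 1 + b ∧ b.degree = d := by
    intro a d h
    obtain ⟨i, hi⟩ : ∃ i, a i ≠ 0 := by
      by_contra! h0
      rw [show a = 0 from Finsupp.ext h0] at h
      simp at h
    have hle : Finsupp.single i 1 ≤ a := Finsupp.single_le_iff.2 (by omega)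
    refine ⟨i, a - Finsupp.single i 1, (add_tsub_cancel_of_le hle).symm, ?_⟩
    have := congrArg Finsupp.degree (add_tsub_cancel_of_le hle)
    rw [map_add, Finsupp.degree_single, h] at this
    omega
  obtain ⟨i, b, rfl, hb⟩ := hpeel a 1 ha
  obtain ⟨j, c, rfl, hc⟩ := hpeel b 0 hb
  rw [(Finsupp.degree_eq_zero_iff c).1 hc, add_zero]
  exact ⟨i, j, rfl⟩

/-- **Corollary 3.1.** Let `I` be a quadratic monomial ideal with linear resolution and
let `P` be a monomial prime ideal (generated by a set of variables) with `I ⊆ P`.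
Then `P^k I^ℓ` has linear quotients for all `k, ℓ ≥ 1`. -/
theorem powers_PI_linearQuotients {K : Type*} [Field K] {n : ℕ}
    (I P : Ideal (MvPolynomial (Fin n) K))
    (hquad : ∃ A : Set (Fin n →₀ ℕ), (∀ a ∈ A, a.sum (fun _ e => e) = 2) ∧
      I = Ideal.span ((fun a => (monomial a (1 : K) : MvPolynomial (Fin n) K)) '' A))
    (hlin : HasLinearResolution I 2)
    (s : Set (Fin n))
    (hP : P = Ideal.span ((fun x => (X x : MvPolynomial (Fin n) K)) '' s))
    (hIP : I ≤ P) :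
    ∀ k l : ℕ, 1 ≤ k → 1 ≤ l → HasLinearQuotients (P ^ k * I ^ l) := by
  intro k l _ _
  obtain ⟨S, hS, hIS⟩ := hquad
  set A : Fin n → Fin n → Prop := fun i j =>
    monomial (Finsupp.single i 1 + Finsupp.single j 1) (1 : K) ∈ I with hA
  have hsymm : ∀ i j, A i j → A j i := by
    intro i j h
    simp only [hA] at h ⊢
    rwa [add_comm]
  have hmon : ∀ p ∈ I, ∀ e, coeff e p ≠ 0 → monomial e (1 : K) ∈ I := by
    intro p hp e he
    rw [hIS, mem_ideal_span_monomial_image] at hp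
    obtain ⟨a, ha, hae⟩ := hp e (mem_support_iff.2 he)
    exact monomial_mem_of_le hae (hIS ▸ Ideal.subset_span ⟨a, ha, rfl⟩)
  obtain ⟨ρ, hρ, hC⟩ := exists_elimination_order hsymm
    (fun i j k => adj_or_adj_of_loop hlin hmon fun _ _ => Iff.rfl)
    (fun W a x ha _ => exists_separation hlin hmon (fun _ _ => Iff.rfl) W ha) Finset.univ
  have hs : ∀ i j, A i j → i ∈ s ∨ j ∈ s := by
    intro i j h
    have h := hIP h
    rw [hP, mem_ideal_span_X_image] at h
    obtain ⟨m, hm, hne⟩ := h (Finsupp.single i 1 + Finsupp.single j 1) (by simp [mem_support_iff])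
    by_cases hi : m = i
    · exact Or.inl (hi ▸ hm)
    by_cases hj : m = j
    · exact Or.inr (hj ▸ hm)
    simp [Ne.symm hi, Ne.symm hj] at hne
  have hI : I = Ideal.span ((fun a => monomial a (1 : K)) ''
      {a | ∃ i j, A i j ∧ a = Finsupp.single i 1 + Finsupp.single j 1}) := by
    apply le_antisymm
    · nth_rw 1 [hIS]
      refine Ideal.span_mono (Set.image_mono fun a ha => ?_)
      obtain ⟨i, j, rfl⟩ := exists_eq_single_add_single (hS a ha)
      refine ⟨i, j, ?_, rfl⟩
      simp only [hA]
      rw [hIS]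
      exact Ideal.subset_span ⟨_, ha, rfl⟩
    · rw [Ideal.span_le]
      rintro _ ⟨_, ⟨i, j, h, rfl⟩, rfl⟩
      exact h
  have hP' : P = Ideal.span ((fun a => monomial a (1 : K)) ''
      {a | ∃ i ∈ s, a = Finsupp.single i 1}) := by
    rw [hP]
    congr 1
    ext p
    constructor
    · rintro ⟨i, hi, rfl⟩
      exact ⟨_, ⟨i, hi, rfl⟩, rfl⟩
    · rintro ⟨_, ⟨i, hi, rfl⟩, rfl⟩
      exact ⟨i, hi, rfl⟩
  obtain ⟨w, hw⟩ := presents_exchange hsymm hs (Set.injOn_univ.1 (by simpa using hρ))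
    (by simpa using hC) k l
  obtain ⟨𝒰, h𝒰⟩ := exists_finset_presents A s k l
  have hset : {U | ∃ E, Presents A s k l U E} = (𝒰 : Set (Fin n →₀ ℕ)) := by
    ext U
    simp [h𝒰]
  rw [pow_mul_pow_eq_span hI hP' k l, hset]
  refine hasLinearQuotients_of_exchange 𝒰 (k + 2 * l) (fun U hU => ?_) w ?_
  · obtain ⟨E, hE⟩ := (h𝒰 U).1 hU
    exact hE.degree
  · simpa only [h𝒰] using hw
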